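/- arXiv:1305.3429 — 3 statements merged into one kernel-verified Lean document; each statement's English description precedes it below -/
import Mathlib

section
/- Fix integers n ≥ 1 and d ≥ 0. The map Hom(ℤ^{2d}, U(n))/U(n) → Hom(ℤ^{2d}, GL(n,ℂ))⁺/GL(n,ℂ) induced by the inclusion U(n) ↪ GL(n,ℂ) is continuous and injective, and its image is a strong deformation retract of Hom(ℤ^{2d}, GL(n,ℂ))⁺/GL(n,ℂ). -/
open Matrix

/-- The space `Hom(ℤ^m, G)` of commuting `m`-tuples with entries in a subset `G`
of a monoid `M`, as a subset of `M^m` (with the subspace topology). -/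
def commTuples {M : Type*} [Monoid M] (m : ℕ) (G : Set M) : Set (Fin m → M) :=
  {f | (∀ i, f i ∈ G) ∧ ∀ i j, f i * f j = f j * f i}

/-- Simultaneous conjugation, by elements of `G` (together with their inverses in `G`),
of tuples lying in a subset `S` of `M^m`. -/
def conjRel {M : Type*} [Monoid M] {m : ℕ} (G : Set M) (S : Set (Fin m → M)) :
    S → S → Prop := fun x y =>
  ∃ g gi : M, g ∈ G ∧ gi ∈ G ∧ g * gi = 1 ∧ gi * g = 1 ∧
    ∀ i, g * (x : Fin m → M) i * gi = (y : Fin m → M) i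

/-- The conjugation orbit space `S/G`, with the quotient topology. -/
abbrev RepSpace {M : Type*} [Monoid M] [TopologicalSpace M] {m : ℕ} (G : Set M)
    (S : Set (Fin m → M)) : Type _ := Quot (conjRel G S)

/-- `A` is a strong deformation retract of `X`. -/
def IsStrongDeformationRetract {X : Type*} [TopologicalSpace X] (A : Set X) : Prop :=
  ∃ H : X × unitInterval → X, Continuous H ∧
    (∀ x, H (x, 0) = x) ∧ (∀ x, H (x, 1) ∈ A) ∧ (∀ a ∈ A, ∀ t, H (a, t) = a)

/-- A complex square matrix is semisimple if it is diagonalizable over `ℂ`. -/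
def IsSemisimpleMat {n : ℕ} (A : Matrix (Fin n) (Fin n) ℂ) : Prop :=
  ∃ P Pi : Matrix (Fin n) (Fin n) ℂ, P * Pi = 1 ∧ Pi * P = 1 ∧ (Pi * A * P).IsDiag

/-- The subspace `Hom(ℤ^m, G)⁺` of commuting `m`-tuples in `G` all of whose entries
are semisimple. -/
def ssTuples (m : ℕ) {n : ℕ} (G : Set (Matrix (Fin n) (Fin n) ℂ)) :
    Set (Fin m → Matrix (Fin n) (Fin n) ℂ) :=
  {f | f ∈ commTuples m G ∧ ∀ i, IsSemisimpleMat (f i)}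

/-- `GL(n,ℂ)` as the set of invertible complex `n × n` matrices. -/
def GLset (n : ℕ) : Set (Matrix (Fin n) (Fin n) ℂ) := {A | IsUnit A}

/-- `U(n)` as a set of complex `n × n` matrices. -/
def Uset (n : ℕ) : Set (Matrix (Fin n) (Fin n) ℂ) := Matrix.unitaryGroup (Fin n) ℂ

/-- `SL(n,ℂ)` as the set of complex `n × n` matrices of determinant one. -/
def SLset (n : ℕ) : Set (Matrix (Fin n) (Fin n) ℂ) := {A | A.det = 1}

/-- `SU(n)` as a set of complex `n × n` matrices. -/
def SUset (n : ℕ) : Set (Matrix (Fin n) (Fin n) ℂ) :=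
  {A | A ∈ Matrix.unitaryGroup (Fin n) ℂ ∧ A.det = 1}

/-- A simultaneous diagonalization of the family `A` with joint eigenvalues `l`. -/
def IsJointEig {n : ℕ} {ι : Type*} (A : ι → Matrix (Fin n) (Fin n) ℂ) (l : ι → Fin n → ℂ) : Prop :=
  ∃ P Q : Matrix (Fin n) (Fin n) ℂ, P * Q = 1 ∧ Q * P = 1 ∧ ∀ i, Q * A i * P = diagonal (l i)

theorem aeval_mul_eq_mul_aeval {n : ℕ} {A P D : Matrix (Fin n) (Fin n) ℂ} (h : A * P = P * D)
    (p : Polynomial ℂ) : Polynomial.aeval A p * P = P * Polynomial.aeval D p := by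
  induction p using Polynomial.induction_on' with
  | add p q hp hq => simp only [map_add, add_mul, mul_add, hp, hq]
  | monomial k a =>
    have hk : A ^ k * P = P * D ^ k := (SemiconjBy.pow_right (show SemiconjBy P D A from h.symm) k).symm
    simp only [Polynomial.aeval_monomial, mul_assoc, hk]
    rw [← mul_assoc, Algebra.commutes, mul_assoc]

theorem IsSemisimpleMat.isSemisimple_toLin' {n : ℕ} {A : Matrix (Fin n) (Fin n) ℂ}
    (hA : IsSemisimpleMat A) : Module.End.IsSemisimple (Matrix.toLin' A) := by
  obtain ⟨P, Q, h1, h2, h3⟩ := hA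
  obtain ⟨D, hD⟩ : ∃ D, diagonal D = Q * A * P := ⟨_, h3.diagonal_diag⟩
  have hAP : A * P = P * diagonal D := by
    rw [hD, ← mul_assoc, ← mul_assoc, h1, one_mul]
  let S := Finset.univ.image D
  let p : Polynomial ℂ := ∏ a ∈ S, (Polynomial.X - Polynomial.C a)
  have hp : Squarefree p := (Polynomial.separable_prod_X_sub_C_iff'.2 (by simp)).squarefree
  have hpD : Polynomial.aeval (diagonal D) p = 0 := by
    have := Polynomial.aeval_algHom_apply (Matrix.diagonalAlgHom (n := Fin n) (α := ℂ) ℂ) D p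
    rw [Matrix.diagonalAlgHom_apply] at this
    rw [this]
    have h0 : Polynomial.aeval D p = 0 := by
      ext j
      rw [Polynomial.aeval_pi_apply]
      simp only [p, Polynomial.coe_aeval_eq_eval, Polynomial.eval_prod, Pi.zero_apply]
      exact Finset.prod_eq_zero (i := D j) (by simp [S]) (by simp)
    rw [h0, map_zero]
  have hpA : Polynomial.aeval A p = 0 := by
    have := aeval_mul_eq_mul_aeval hAP p
    rw [hpD, mul_zero] at this
    rw [← mul_one (Polynomial.aeval A p), ← h1, ← mul_assoc, this, zero_mul]
  refine Module.End.isSemisimple_of_squarefree_aeval_eq_zero hp ?_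
  have := Polynomial.aeval_algHom_apply (Matrix.toLinAlgEquiv' (R := ℂ) (n := Fin n)).toAlgHom A p
  rw [hpA, map_zero] at this
  exact this

theorem exists_isJointEig {n : ℕ} {ι : Type*} (A : ι → Matrix (Fin n) (Fin n) ℂ)
    (hc : ∀ i j, A i * A j = A j * A i) (hs : ∀ i, IsSemisimpleMat (A i)) :
    ∃ l, IsJointEig A l := by
  let f : ι → Module.End ℂ (Fin n → ℂ) := fun i => Matrix.toLin' (A i)
  have hf : ∀ i μ, (f i).maxGenEigenspace μ = (f i).eigenspace μ := fun i μ =>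
    (hs i).isSemisimple_toLin'.isFinitelySemisimple.maxGenEigenspace_eq_eigenspace μ
  have htop := Module.End.iSup_iInf_maxGenEigenspace_eq_top_of_iSup_maxGenEigenspace_eq_top_of_commute
    f (fun i j _ => by
      change f i * f j = f j * f i
      simp only [f, Module.End.mul_eq_comp, ← Matrix.toLin'_mul, hc i j])
    (fun i => Module.End.iSup_maxGenEigenspace_eq_top _)
  simp only [hf] at htop
  let s : Set (Fin n → ℂ) := {v | ∃ χ : ι → ℂ, ∀ i, A i *ᵥ v = χ i • v}
  have hspan : ⊤ ≤ Submodule.span ℂ s := by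
    rw [← htop]
    refine iSup_le fun χ v hv => Submodule.subset_span ⟨χ, fun i => ?_⟩
    rw [Submodule.mem_iInf] at hv
    simpa [f] using Module.End.mem_eigenspace_iff.1 (hv i)
  let b₀ := Module.Basis.ofSpan hspan
  have : Fintype ((linearIndepOn_empty ℂ id).extend (Set.empty_subset s)) :=
    FiniteDimensional.fintypeBasisIndex b₀
  let b : Module.Basis (Fin n) ℂ (Fin n → ℂ) := b₀.reindex (Fintype.equivFinOfCardEq (by
    rw [← Module.finrank_eq_card_basis b₀, Module.finrank_fin_fun]))
  have hb : ∀ j, b j ∈ s := fun j => by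
    rw [Module.Basis.reindex_apply]
    exact Module.Basis.ofSpan_subset hspan ⟨_, rfl⟩
  choose χ hχ using hb
  refine ⟨fun i j => χ j i, (Pi.basisFun ℂ (Fin n)).toMatrix b, b.toMatrix (Pi.basisFun ℂ (Fin n)),
    Module.Basis.toMatrix_mul_toMatrix_flip _ _, Module.Basis.toMatrix_mul_toMatrix_flip _ _,
    fun i => ?_⟩
  have hAP : A i * (Pi.basisFun ℂ (Fin n)).toMatrix b
      = (Pi.basisFun ℂ (Fin n)).toMatrix b * diagonal (fun j => χ j i) := by
    ext k j
    have := congrFun (hχ j i) k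
    rw [Matrix.mul_diagonal]
    simpa [Matrix.mul_apply, Matrix.mulVec, dotProduct, Module.Basis.toMatrix_apply, mul_comm] using this
  rw [mul_assoc, hAP, ← mul_assoc, Module.Basis.toMatrix_mul_toMatrix_flip, one_mul]

theorem Matrix.IsHermitian.isSemisimpleMat {n : ℕ} {A : Matrix (Fin n) (Fin n) ℂ} (hA : A.IsHermitian) :
    IsSemisimpleMat A := by
  refine ⟨hA.eigenvectorUnitary, star (hA.eigenvectorUnitary : Matrix (Fin n) (Fin n) ℂ),
    by simp, by simp, ?_⟩
  have := hA.conjStarAlgAut_star_eigenvectorUnitary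
  rw [Unitary.conjStarAlgAut_apply] at this
  simp only [Unitary.coe_star, star_star] at this
  rw [this]
  exact isDiag_diagonal _

theorem isSemisimpleMat_of_mem_unitaryGroup {n : ℕ} {A : Matrix (Fin n) (Fin n) ℂ}
    (hA : A ∈ Matrix.unitaryGroup (Fin n) ℂ) : IsSemisimpleMat A := by
  have h1 : Aᴴ * A = 1 := (Matrix.mem_unitaryGroup_iff').1 hA
  have h2 : A * Aᴴ = 1 := (Matrix.mem_unitaryGroup_iff).1 hA
  let B : Fin 2 → Matrix (Fin n) (Fin n) ℂ := ![A + Aᴴ, Complex.I • (A - Aᴴ)]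
  have hcomm : B 0 * B 1 = B 1 * B 0 := by
    simp only [B, Matrix.cons_val_zero, Matrix.cons_val_one, Matrix.mul_smul, Matrix.smul_mul]
    congr 1
    simp only [add_mul, mul_sub, sub_mul, mul_add, h1, h2]
    abel
  obtain ⟨l, P, Q, hP, hQ, hl⟩ := exists_isJointEig B
    (fun i j => by fin_cases i <;> fin_cases j <;> first | rfl | exact hcomm | exact hcomm.symm)
    (fun i => by
      apply Matrix.IsHermitian.isSemisimpleMat
      fin_cases i
      · simp [B, Matrix.IsHermitian, add_comm]
      · simp [B, Matrix.IsHermitian, Matrix.conjTranspose_smul, ← smul_neg])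
  refine ⟨P, Q, hP, hQ, ?_⟩
  have hAB : A = (1 / 2 : ℂ) • (B 0 - Complex.I • B 1) := by
    simp only [B, Matrix.cons_val_zero, Matrix.cons_val_one, smul_smul, Complex.I_mul_I]
    module
  have : Q * A * P = (1 / 2 : ℂ) • (diagonal (l 0) - Complex.I • diagonal (l 1)) := by
    rw [← hl, ← hl]
    conv_lhs => rw [hAB]
    simp only [Matrix.mul_smul, Matrix.smul_mul, mul_sub, sub_mul]
  rw [this]
  exact ((isDiag_diagonal _).sub ((isDiag_diagonal _).smul _)).smul _

/-- The polar decomposition trick: unitary tuples conjugate under `GL` are conjugate under `U`. -/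
theorem exists_unitary_conj {n : ℕ} {ι : Type*} {A B : ι → Matrix (Fin n) (Fin n) ℂ}
    (hA : ∀ i, A i ∈ Matrix.unitaryGroup (Fin n) ℂ) (hB : ∀ i, B i ∈ Matrix.unitaryGroup (Fin n) ℂ)
    {g : Matrix (Fin n) (Fin n) ℂ} (hg : IsUnit g) (h : ∀ i, g * A i = B i * g) :
    ∃ u ∈ Matrix.unitaryGroup (Fin n) ℂ, ∀ i, u * A i = B i * u := by
  open scoped MatrixOrder in
  open scoped Matrix.Norms.L2Operator in
  have h0 : 0 ≤ star g * g := star_mul_self_nonneg g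
  have hcomm : ∀ i, Commute (star g * g) (A i) := fun i => by
    have hA1 : A i * star (A i) = 1 := (Matrix.mem_unitaryGroup_iff).1 (hA i)
    have hB1 : star (B i) * B i = 1 := (Matrix.mem_unitaryGroup_iff').1 (hB i)
    have h3 : star (A i) * star g = star g * star (B i) := by
      rw [← star_mul, ← star_mul, h i]
    have h4 : star g = A i * star g * star (B i) := by
      rw [mul_assoc, ← h3, ← mul_assoc, hA1, one_mul]
    change star g * g * A i = A i * (star g * g)
    calc star g * g * A i = star g * (B i * g) := by rw [mul_assoc, h i]
      _ = (A i * star g * star (B i)) * (B i * g) := by rw [← h4]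
      _ = A i * star g * (star (B i) * B i) * g := by simp only [mul_assoc]
      _ = _ := by rw [hB1, mul_one, mul_assoc]
  let p := CFC.sqrt (star g * g)
  have hpp : p * p = star g * g := CFC.sqrt_mul_sqrt_self _ h0
  have hps : star p = p := (CFC.sqrt_nonneg (star g * g)).star_eq
  have hpA : ∀ i, p * A i = A i * p := fun i => (hcomm i).cfcₙ_nnreal _
  have hpu : IsUnit p := (CFC.isUnit_sqrt_iff _ h0).2 (hg.star.mul hg)
  obtain ⟨⟨p', q, hpq, hqp⟩, hp'⟩ := hpu
  obtain rfl : p' = p := hp'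
  have hqs : star q = q := by
    have : star q * p = 1 := by rw [← hps, ← star_mul, hpq, star_one]
    calc star q = star q * (p * q) := by rw [hpq, mul_one]
      _ = q := by rw [← mul_assoc, this, one_mul]
  have hqA : ∀ i, q * A i = A i * q := fun i => by
    calc q * A i = q * (A i * p) * q := by rw [mul_assoc, mul_assoc, hpq, mul_one]
      _ = _ := by rw [← hpA, ← mul_assoc, hqp, one_mul]
  refine ⟨g * q, ?_, fun i => ?_⟩
  · rw [Matrix.mem_unitaryGroup_iff', star_mul, hqs, mul_assoc, ← mul_assoc (star g), ← hpp,
      mul_assoc p, hpq, mul_one, hqp]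
  · rw [mul_assoc, hqA, ← mul_assoc, h, mul_assoc]

theorem exists_perm_of_prod_sub_eq {n : ℕ} {ι : Type*} [Fintype ι] {l l' : ι → Fin n → ℂ}
    (h : ∀ (s : ι → ℂ) (t : ℂ), ∏ j, (t - ∑ i, s i * l i j) = ∏ j, (t - ∑ i, s i * l' i j)) :
    ∃ σ : Equiv.Perm (Fin n), ∀ i j, l' i (σ j) = l i j := by
  classical
  let c : Fin n ⊕ Fin n → ι → ℂ := Sum.elim (fun j i => l i j) (fun j i => l' i j)
  obtain ⟨f, hf⟩ := Module.exists_dual_forall_apply_ne_zero (K := ℂ)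
    (fun p : {p : (Fin n ⊕ Fin n) × (Fin n ⊕ Fin n) // c p.1 ≠ c p.2} => c p.1.1 - c p.1.2)
    (fun p => sub_ne_zero.2 p.2)
  have hinj : ∀ x y, f (c x) = f (c y) → c x = c y := fun x y hxy => by
    by_contra hne
    exact hf ⟨(x, y), hne⟩ (by simp [hxy])
  have hfs : ∀ v : ι → ℂ, f v = ∑ i, f (Pi.single i 1) * v i := fun v => by
    rw [LinearMap.pi_apply_eq_sum_univ f v]
    refine Finset.sum_congr rfl fun i _ => ?_
    rw [smul_eq_mul, mul_comm]
    congr 2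
    ext k
    simp [Pi.single_apply, eq_comm]
  have hpoly : ∏ j, (Polynomial.X - Polynomial.C (f (c (Sum.inl j))))
      = ∏ j, (Polynomial.X - Polynomial.C (f (c (Sum.inr j)))) := by
    refine Polynomial.funext fun t => ?_
    simp only [Polynomial.eval_prod, Polynomial.eval_sub, Polynomial.eval_X, Polynomial.eval_C]
    simp_rw [hfs (c _)]
    exact h _ t
  have hroots : Finset.univ.val.map (fun j => f (c (Sum.inl j)))
      = Finset.univ.val.map (fun j => f (c (Sum.inr j))) := by
    have h1 := Polynomial.roots_multiset_prod_X_sub_C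
      (Finset.univ.val.map (fun j => f (c (Sum.inl j))))
    have h2 := Polynomial.roots_multiset_prod_X_sub_C
      (Finset.univ.val.map (fun j => f (c (Sum.inr j))))
    rw [Multiset.map_map] at h1 h2
    rw [← h1, ← h2]
    exact congrArg Polynomial.roots hpoly
  have hcard : ∀ z, Fintype.card {j // f (c (Sum.inl j)) = z}
      = Fintype.card {j // f (c (Sum.inr j)) = z} := fun z => by
    have := congrArg (Multiset.count z) hroots
    rw [Multiset.count_map, Multiset.count_map] at this
    rw [Fintype.card_subtype, Fintype.card_subtype]
    convert this using 3
    all_goals exact congrArg _ (Finset.filter_congr fun j _ => eq_comm)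
  let σ := Equiv.ofFiberEquiv (f := fun j => f (c (Sum.inl j))) (g := fun j => f (c (Sum.inr j)))
    (fun z => Fintype.equivOfCardEq (hcard z))
  refine ⟨σ, fun i j => ?_⟩
  have := Equiv.ofFiberEquiv_map (f := fun j => f (c (Sum.inl j)))
    (g := fun j => f (c (Sum.inr j))) (fun z => Fintype.equivOfCardEq (hcard z)) j
  exact congrFun (hinj _ _ this) i

namespace IsJointEig

variable {n : ℕ} {ι : Type*} {A : ι → Matrix (Fin n) (Fin n) ℂ} {l l' : ι → Fin n → ℂ}

theorem det_sub_sum [Fintype ι] (h : IsJointEig A l) (s : ι → ℂ) (t : ℂ) :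
    (t • (1 : Matrix (Fin n) (Fin n) ℂ) - ∑ i, s i • A i).det = ∏ j, (t - ∑ i, s i * l i j) := by
  obtain ⟨P, Q, hPQ, hQP, hl⟩ := h
  have : Q * (t • (1 : Matrix (Fin n) (Fin n) ℂ) - ∑ i, s i • A i) * P
      = diagonal fun j => t - ∑ i, s i * l i j := by
    simp only [mul_sub, sub_mul, Finset.mul_sum, Finset.sum_mul, Matrix.mul_smul, Matrix.smul_mul,
      mul_one, hQP, hl]
    ext j k
    rcases eq_or_ne j k with rfl | hjk
    · simp [Matrix.sum_apply]
    · simp [Matrix.sum_apply, hjk]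
  rw [← Matrix.det_diagonal, ← this, Matrix.det_mul_right_comm, hQP, one_mul]

theorem det_eq (h : IsJointEig A l) (i : ι) : (A i).det = ∏ j, l i j := by
  obtain ⟨P, Q, hPQ, hQP, hl⟩ := h
  rw [← Matrix.det_diagonal, ← hl, Matrix.det_mul_right_comm, hQP, one_mul]

theorem ne_zero (h : IsJointEig A l) {i : ι} (hA : IsUnit (A i)) (j : Fin n) : l i j ≠ 0 := by
  have := ((Matrix.isUnit_iff_isUnit_det _).1 hA).ne_zero
  rw [h.det_eq] at this
  exact Finset.prod_ne_zero_iff.1 this j (Finset.mem_univ j)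

theorem hasEigenvalue (h : IsJointEig A l) (i : ι) (j : Fin n) :
    Module.End.HasEigenvalue (Matrix.toLin' (A i)) (l i j) := by
  obtain ⟨P, Q, hPQ, hQP, hl⟩ := h
  refine Module.End.hasEigenvalue_of_hasEigenvector (x := P *ᵥ Pi.single j 1) ⟨?_, fun h0 => ?_⟩
  · rw [Module.End.mem_eigenspace_iff, Matrix.toLin'_apply, Matrix.mulVec_mulVec]
    have : A i * P = P * diagonal (l i) := by rw [← hl, ← mul_assoc, ← mul_assoc, hPQ, one_mul]
    rw [this, ← Matrix.mulVec_mulVec, ← Matrix.mulVec_smul]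
    congr 1
    ext k
    rw [Matrix.mulVec_diagonal]
    rcases eq_or_ne k j with rfl | hk <;> simp [*]
  · have := congrArg (fun v => (Q *ᵥ v) j) h0
    simp only [Matrix.mulVec_mulVec, hQP] at this
    simp at this

theorem norm_le (h : IsJointEig A l) (i : ι) (j : Fin n) :
    ‖l i j‖ ≤ ∑ k, ∑ k', ‖A i k k'‖ := by
  obtain ⟨k, hk⟩ := eigenvalue_mem_ball (h.hasEigenvalue i j)
  rw [mem_closedBall_iff_norm] at hk
  calc ‖l i j‖ ≤ ‖A i k k‖ + ‖l i j - A i k k‖ := norm_le_norm_add_norm_sub' _ _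
    _ ≤ ‖A i k k‖ + ∑ k' ∈ Finset.univ.erase k, ‖A i k k'‖ := by gcongr
    _ = ∑ k', ‖A i k k'‖ := Finset.add_sum_erase _ (fun k' => ‖A i k k'‖) (Finset.mem_univ k)
    _ ≤ _ := Finset.single_le_sum (f := fun k => ∑ k', ‖A i k k'‖)
      (fun _ _ => Finset.sum_nonneg fun _ _ => norm_nonneg _) (Finset.mem_univ k)

theorem norm_eq_one (h : IsJointEig A l) {i : ι} (hA : A i ∈ Matrix.unitaryGroup (Fin n) ℂ)
    (j : Fin n) : ‖l i j‖ = 1 := by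
  open scoped Matrix.Norms.L2Operator in
  have h1 := (h.hasEigenvalue i j).mem_spectrum
  rw [Matrix.spectrum_toLin'] at h1
  exact mem_sphere_zero_iff_norm.1 (spectrum.subset_circle_of_unitary hA h1)

theorem exists_perm [Fintype ι] (h : IsJointEig A l) (h' : IsJointEig A l') :
    ∃ σ : Equiv.Perm (Fin n), ∀ i j, l' i (σ j) = l i j :=
  exists_perm_of_prod_sub_eq fun s t => by rw [← h.det_sub_sum, ← h'.det_sub_sum]

theorem conj (h : IsJointEig A l) {g g' : Matrix (Fin n) (Fin n) ℂ} (h1 : g * g' = 1)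
    (h2 : g' * g = 1) : IsJointEig (fun i => g * A i * g') l := by
  obtain ⟨P, Q, hPQ, hQP, hl⟩ := h
  refine ⟨g * P, Q * g', ?_, ?_, fun i => ?_⟩
  · rw [mul_assoc, ← mul_assoc P, hPQ, one_mul, h1]
  · rw [mul_assoc, ← mul_assoc g', h2, one_mul, hQP]
  · calc Q * g' * (g * A i * g') * (g * P) = Q * (g' * g) * A i * (g' * g) * P := by
          simp only [mul_assoc]
      _ = _ := by rw [h2, mul_one, mul_one, hl]

theorem diagonal_perm (l : ι → Fin n → ℂ) (σ : Equiv.Perm (Fin n)) :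
    IsJointEig (fun i => diagonal (l i)) (fun i j => l i (σ j)) := by
  refine ⟨σ⁻¹.permMatrix ℂ, σ.permMatrix ℂ, ?_, ?_, fun i => ?_⟩
  · rw [← Matrix.permMatrix_mul, mul_inv_cancel, Matrix.permMatrix_one]
  · rw [← Matrix.permMatrix_mul, inv_mul_cancel, Matrix.permMatrix_one]
  · rw [PEquiv.toMatrix_toPEquiv_mul, PEquiv.mul_toMatrix_toPEquiv]
    ext j k
    change (if σ j = σ k then l i (σ j) else 0) = if j = k then l i (σ j) else 0
    simp only [σ.injective.eq_iff]

end IsJointEig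

/-- `m`-tuples of invertible diagonal matrices, recorded by their diagonal entries. -/
abbrev DiagTuple (m n : ℕ) : Type := {l : Fin m → Fin n → ℂ // ∀ i j, l i j ≠ 0}

namespace DiagTuple

variable {m n : ℕ}

/-- Radial flow of the diagonal entries onto the unit circle. -/
noncomputable def flow (l : DiagTuple m n) (t : unitInterval) : DiagTuple m n :=
  ⟨fun i j => l.1 i j * ((‖l.1 i j‖ ^ (-(t : ℝ)) : ℝ) : ℂ), fun i j =>
    mul_ne_zero (l.2 i j) (Complex.ofReal_ne_zero.2
      (Real.rpow_pos_of_pos (norm_pos_iff.2 (l.2 i j)) _).ne')⟩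

theorem continuous_flow : Continuous fun p : DiagTuple m n × unitInterval => p.1.flow p.2 := by
  refine Continuous.subtype_mk (continuous_pi fun i => continuous_pi fun j => ?_) _
  have h : Continuous fun p : DiagTuple m n × unitInterval => p.1.1 i j :=
    (continuous_apply_apply i j).comp (continuous_subtype_val.comp continuous_fst)
  refine h.mul (Complex.continuous_ofReal.comp ?_)
  exact h.norm.rpow (by fun_prop) fun p => Or.inl (norm_ne_zero_iff.2 (p.1.2 i j))

theorem flow_zero (l : DiagTuple m n) : l.flow 0 = l := by
  ext i j
  simp [flow]

theorem flow_of_norm_eq_one {l : DiagTuple m n} (hl : ∀ i j, ‖l.1 i j‖ = 1) (t : unitInterval) :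
    l.flow t = l := by
  ext i j
  simp [flow, hl]

theorem norm_flow_one (l : DiagTuple m n) (i : Fin m) (j : Fin n) : ‖(l.flow 1).1 i j‖ = 1 := by
  have := norm_pos_iff.2 (l.2 i j)
  simp [flow, Real.rpow_neg_one, this.ne']

/-- The tuple of diagonal matrices, as a tuple of commuting semisimple matrices. -/
def toSsTuples (l : DiagTuple m n) : ssTuples m (GLset n) :=
  ⟨fun i => diagonal (l.1 i), ⟨fun i => (Matrix.isUnit_iff_isUnit_det _).2 (by
      rw [Matrix.det_diagonal]
      exact (Finset.prod_ne_zero_iff.2 fun j _ => l.2 i j).isUnit),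
    fun i j => by simp only [Matrix.diagonal_mul_diagonal, mul_comm]⟩,
    fun i => ⟨1, 1, by simp, by simp, by simp⟩⟩

/-- The conjugacy class of a tuple of diagonal matrices. -/
def toRep (l : DiagTuple m n) : RepSpace (GLset n) (ssTuples m (GLset n)) :=
  Quot.mk _ l.toSsTuples

theorem continuous_toRep : Continuous (toRep : DiagTuple m n → _) := by
  refine continuous_quot_mk.comp (Continuous.subtype_mk (continuous_pi fun i => ?_) _)
  exact Continuous.matrix_diagonal ((continuous_apply i).comp continuous_subtype_val)

theorem toRep_eq_mk {l : DiagTuple m n} {A : ssTuples m (GLset n)} (h : IsJointEig A.1 l.1) :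
    l.toRep = Quot.mk _ A := by
  obtain ⟨P, Q, hPQ, hQP, hl⟩ := h
  refine Quot.sound ⟨P, Q, ⟨⟨P, Q, hPQ, hQP⟩, rfl⟩, ⟨⟨Q, P, hQP, hPQ⟩, rfl⟩, hPQ, hQP, fun i => ?_⟩
  change P * diagonal (l.1 i) * Q = A.1 i
  rw [← hl, ← mul_assoc, ← mul_assoc, hPQ, one_mul, mul_assoc, hPQ, mul_one]

theorem toRep_flow_eq {l l' : DiagTuple m n} {σ : Equiv.Perm (Fin n)}
    (h : ∀ i j, l'.1 i (σ j) = l.1 i j) (t : unitInterval) :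
    (l.flow t).toRep = (l'.flow t).toRep := by
  refine toRep_eq_mk ?_
  have := IsJointEig.diagonal_perm (l'.flow t).1 σ
  rwa [show (fun i j => (l'.flow t).1 i (σ j)) = (l.flow t).1 by ext i j; simp [flow, h]] at this

end DiagTuple

theorem exists_diagTuple {m n : ℕ} (A : ssTuples m (GLset n)) :
    ∃ l : DiagTuple m n, IsJointEig A.1 l.1 := by
  obtain ⟨l, hl⟩ := exists_isJointEig A.1 A.2.1.2 A.2.2
  exact ⟨⟨l, fun i j => hl.ne_zero (A.2.1.1 i) j⟩, hl⟩

/-- The radial flow on conjugacy classes of tuples of commuting semisimple matrices. -/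
noncomputable def ssFlow {m n : ℕ} (A : ssTuples m (GLset n)) (t : unitInterval) :
    RepSpace (GLset n) (ssTuples m (GLset n)) :=
  ((exists_diagTuple A).choose.flow t).toRep

theorem ssFlow_eq {m n : ℕ} {A : ssTuples m (GLset n)} {l : DiagTuple m n}
    (h : IsJointEig A.1 l.1) (t : unitInterval) : ssFlow A t = (l.flow t).toRep := by
  obtain ⟨σ, hσ⟩ := (exists_diagTuple A).choose_spec.exists_perm h
  exact DiagTuple.toRep_flow_eq hσ t

theorem ssFlow_zero {m n : ℕ} (A : ssTuples m (GLset n)) : ssFlow A 0 = Quot.mk _ A := by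
  obtain ⟨l, hl⟩ := exists_diagTuple A
  rw [ssFlow_eq hl, DiagTuple.flow_zero, DiagTuple.toRep_eq_mk hl]

theorem ssFlow_of_conjRel {m n : ℕ} {A B : ssTuples m (GLset n)}
    (h : conjRel (GLset n) (ssTuples m (GLset n)) A B) : ssFlow A = ssFlow B := by
  obtain ⟨g, g', -, -, h1, h2, hAB⟩ := h
  obtain ⟨l, hl⟩ := exists_diagTuple A
  have hl' : IsJointEig B.1 l.1 := by
    rw [show B.1 = fun i => g * A.1 i * g' from funext fun i => (hAB i).symm]
    exact hl.conj h1 h2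
  funext t
  rw [ssFlow_eq hl, ssFlow_eq hl']

/-- Joint eigenvalues of a convergent sequence of tuples subconverge to joint eigenvalues
of the limit, up to a permutation. -/
theorem exists_subseq_jointEig {m n : ℕ} {A : ℕ → Fin m → Matrix (Fin n) (Fin n) ℂ}
    {A₀ : Fin m → Matrix (Fin n) (Fin n) ℂ} {l : ℕ → Fin m → Fin n → ℂ} {l₀ : Fin m → Fin n → ℂ}
    (hA : Filter.Tendsto A Filter.atTop (nhds A₀)) (hl : ∀ k, IsJointEig (A k) (l k))
    (hl₀ : IsJointEig A₀ l₀) :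
    ∃ (l' : Fin m → Fin n → ℂ) (σ : Equiv.Perm (Fin n)) (φ : ℕ → ℕ), StrictMono φ ∧
      Filter.Tendsto (l ∘ φ) Filter.atTop (nhds l') ∧ ∀ i j, l₀ i (σ j) = l' i j := by
  have hcont : Continuous fun B : Fin m → Matrix (Fin n) (Fin n) ℂ =>
      ∑ i, ∑ k, ∑ k', ‖B i k k'‖ := by fun_prop
  obtain ⟨C, hC⟩ := ((hcont.tendsto A₀).comp hA).bddAbove_range
  have hbound : ∀ k, l k ∈ Metric.closedBall (0 : Fin m → Fin n → ℂ) (max C 0) := fun k => by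
    rw [mem_closedBall_zero_iff, pi_norm_le_iff_of_nonneg (le_max_right _ _)]
    refine fun i => (pi_norm_le_iff_of_nonneg (le_max_right _ _)).2 fun j => ?_
    calc ‖l k i j‖ ≤ ∑ a, ∑ b, ‖A k i a b‖ := (hl k).norm_le i j
      _ ≤ ∑ i, ∑ a, ∑ b, ‖A k i a b‖ :=
        Finset.single_le_sum (f := fun i => ∑ a, ∑ b, ‖A k i a b‖)
          (fun _ _ => Finset.sum_nonneg fun _ _ => Finset.sum_nonneg fun _ _ => norm_nonneg _)
          (Finset.mem_univ i)
      _ ≤ C := hC ⟨k, rfl⟩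
      _ ≤ max C 0 := le_max_left _ _
  obtain ⟨l', -, φ, hφ, hl'⟩ := (isCompact_closedBall _ _).tendsto_subseq hbound
  obtain ⟨σ, hσ⟩ := exists_perm_of_prod_sub_eq (l := l') (l' := l₀) fun s t => by
    have hdet : Continuous fun B : Fin m → Matrix (Fin n) (Fin n) ℂ =>
        (t • (1 : Matrix (Fin n) (Fin n) ℂ) - ∑ i, s i • B i).det :=
      Continuous.matrix_det (by fun_prop)
    have hprod : Continuous fun x : Fin m → Fin n → ℂ => ∏ j, (t - ∑ i, s i * x i j) := by
      fun_prop
    have h1 := (hdet.tendsto A₀).comp (hA.comp hφ.tendsto_atTop)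
    have h2 := (hprod.tendsto l').comp hl'
    rw [← hl₀.det_sub_sum]
    refine tendsto_nhds_unique (h2.congr fun k => ?_) h1
    exact ((hl _).det_sub_sum s t).symm
  exact ⟨l', σ, φ, hφ, hl', hσ⟩

theorem continuous_ssFlow {m n : ℕ} :
    Continuous fun p : ssTuples m (GLset n) × unitInterval => ssFlow p.1 p.2 := by
  have : FirstCountableTopology (Matrix (Fin n) (Fin n) ℂ) :=
    inferInstanceAs (FirstCountableTopology (Fin n → Fin n → ℂ))
  refine continuous_iff_seqContinuous.2 fun x p hx => ?_
  refine Filter.tendsto_of_subseq_tendsto fun ns hns => ?_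
  have hy := hx.comp hns
  obtain ⟨l₀, hl₀⟩ := exists_diagTuple p.1
  choose l hl using fun k => exists_diagTuple (x (ns k)).1
  have hA : Filter.Tendsto (fun k => (x (ns k)).1.1) Filter.atTop (nhds p.1.1) :=
    ((continuous_subtype_val.comp continuous_fst).tendsto p).comp hy
  obtain ⟨l', σ, φ, hφ, hl', hσ⟩ := exists_subseq_jointEig hA hl hl₀
  refine ⟨φ, ?_⟩
  let L : DiagTuple m n := ⟨l', fun i j => hσ i j ▸ l₀.2 i (σ j)⟩
  have hL : Filter.Tendsto (l ∘ φ) Filter.atTop (nhds L) := tendsto_subtype_rng.2 hl'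
  have ht : Filter.Tendsto (fun k => (x (ns (φ k))).2) Filter.atTop (nhds p.2) :=
    (continuous_snd.tendsto p).comp (hy.comp hφ.tendsto_atTop)
  have hlim : ssFlow p.1 p.2 = (L.flow p.2).toRep := by
    rw [ssFlow_eq hl₀]
    exact (DiagTuple.toRep_flow_eq hσ p.2).symm
  rw [hlim]
  refine (((DiagTuple.continuous_toRep.comp DiagTuple.continuous_flow).tendsto (L, p.2)).comp
    (hL.prodMk_nhds ht)).congr fun k => ?_
  exact (ssFlow_eq (hl (φ k)) _).symm

/-- The radial deformation of the space of conjugacy classes. -/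
noncomputable def repFlow (m n : ℕ) :
    C(RepSpace (GLset n) (ssTuples m (GLset n)),
      C(unitInterval, RepSpace (GLset n) (ssTuples m (GLset n)))) where
  toFun := Quot.lift (ContinuousMap.curry ⟨_, continuous_ssFlow⟩) fun _ _ h =>
    ContinuousMap.ext fun t => congrFun (ssFlow_of_conjRel h) t
  continuous_toFun := continuous_quot_lift _ (map_continuous _)

theorem commTuples_Uset_subset {m n : ℕ} :
    commTuples m (Uset n) ⊆ ssTuples m (GLset n) := fun A hA =>
  ⟨⟨fun i => ⟨Unitary.toUnits ⟨A i, hA.1 i⟩, rfl⟩, hA.2⟩,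
    fun i => isSemisimpleMat_of_mem_unitaryGroup (hA.1 i)⟩

theorem mem_GLset_of_mem_Uset {n : ℕ} {g : Matrix (Fin n) (Fin n) ℂ} (hg : g ∈ Uset n) :
    g ∈ GLset n :=
  ⟨Unitary.toUnits ⟨g, hg⟩, rfl⟩

/-- The map of orbit spaces induced by `U(n) ↪ GL(n,ℂ)`. -/
def unitaryRepMap (m n : ℕ) : RepSpace (Uset n) (commTuples m (Uset n)) →
    RepSpace (GLset n) (ssTuples m (GLset n)) :=
  Quot.map (Set.inclusion commTuples_Uset_subset) fun _ _ ⟨g, g', hg, hg', h⟩ =>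
    ⟨g, g', mem_GLset_of_mem_Uset hg, mem_GLset_of_mem_Uset hg', h⟩

theorem continuous_unitaryRepMap (m n : ℕ) : Continuous (unitaryRepMap m n) :=
  continuous_quot_lift _ (continuous_quot_mk.comp (continuous_inclusion commTuples_Uset_subset))

theorem conjRel_GLset_equivalence {m n : ℕ} (S : Set (Fin m → Matrix (Fin n) (Fin n) ℂ)) :
    Equivalence (conjRel (GLset n) S) where
  refl A := ⟨1, 1, isUnit_one, isUnit_one, by simp, by simp, by simp⟩
  symm := by
    rintro A B ⟨g, g', hg, hg', h1, h2, h⟩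
    refine ⟨g', g, hg', hg, h2, h1, fun i => ?_⟩
    rw [← h, ← mul_assoc, ← mul_assoc, h2, one_mul, mul_assoc, h2, mul_one]
  trans := by
    rintro A B C ⟨g, g', hg, hg', h1, h2, h⟩ ⟨k, k', hk, hk', h3, h4, h'⟩
    refine ⟨k * g, g' * k', hk.mul hg, hg'.mul hk', ?_, ?_, fun i => ?_⟩
    · rw [mul_assoc, ← mul_assoc g, h1, one_mul, h3]
    · rw [mul_assoc, ← mul_assoc k', h4, one_mul, h2]
    · rw [← h', ← h]
      simp only [mul_assoc]

theorem injective_unitaryRepMap (m n : ℕ) : Function.Injective (unitaryRepMap m n) := by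
  rintro ⟨A⟩ ⟨B⟩ hAB
  obtain ⟨g, g', hg, -, h1, h2, h⟩ :=
    (Equivalence.quot_mk_eq_iff (conjRel_GLset_equivalence _) _ _).1 hAB
  obtain ⟨u, hu, hu'⟩ := exists_unitary_conj A.2.1 B.2.1 hg fun i => by
    have : g * A.1 i * g' = B.1 i := h i
    rw [← this, mul_assoc _ g', h2, mul_one]
  have hu1 : u * star u = 1 := (Matrix.mem_unitaryGroup_iff).1 hu
  refine Quot.sound ⟨u, star u, hu, Unitary.star_mem hu, hu1,
    (Matrix.mem_unitaryGroup_iff').1 hu, fun i => ?_⟩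
  rw [hu', mul_assoc, hu1, mul_one]

theorem DiagTuple.toRep_mem_range {m n : ℕ} {l : DiagTuple m n} (hl : ∀ i j, ‖l.1 i j‖ = 1) :
    l.toRep ∈ Set.range (unitaryRepMap m n) := by
  refine ⟨Quot.mk _ ⟨fun i => diagonal (l.1 i), fun i => ?_, l.toSsTuples.2.1.2⟩, rfl⟩
  refine Matrix.mem_unitaryGroup_iff.2 ?_
  rw [Matrix.star_eq_conjTranspose, Matrix.diagonal_conjTranspose, Matrix.diagonal_mul_diagonal,
    ← Matrix.diagonal_one]
  congr 1
  ext j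
  simp [Complex.mul_conj', hl]

theorem isStrongDeformationRetract_range_unitaryRepMap (m n : ℕ) :
    IsStrongDeformationRetract (Set.range (unitaryRepMap m n)) := by
  refine ⟨fun p => repFlow m n p.1 p.2,
    ContinuousMap.continuous_uncurry_of_continuous (repFlow m n), ?_, ?_, ?_⟩
  · rintro ⟨A⟩
    exact ssFlow_zero A
  · rintro ⟨A⟩
    exact DiagTuple.toRep_mem_range (DiagTuple.norm_flow_one _)
  · rintro _ ⟨⟨A⟩, rfl⟩ t
    obtain ⟨l, hl⟩ := exists_diagTuple (Set.inclusion commTuples_Uset_subset A)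
    refine (ssFlow_eq hl t).trans ?_
    rw [DiagTuple.flow_of_norm_eq_one fun i j => hl.norm_eq_one (A.2.1 i) j]
    exact DiagTuple.toRep_eq_mk hl

/-- Theorem 4.3 of Biswas–Florentino for `G = GL(n,ℂ)`, `K = U(n)`:
the map `Hom(ℤ^{2d},U(n))/U(n) → Hom(ℤ^{2d},GL(n,ℂ))⁺/GL(n,ℂ)` induced by the
inclusion `U(n) ↪ GL(n,ℂ)` is continuous and injective, and its image is a strong
deformation retract of `Hom(ℤ^{2d},GL(n,ℂ))⁺/GL(n,ℂ)`. -/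
theorem commuting_tuples_unitary_retract_of_generalLinear (n d : ℕ) (hn : 1 ≤ n) :
    ∃ φ : RepSpace (Uset n) (commTuples (2*d) (Uset n)) →
          RepSpace (GLset n) (ssTuples (2*d) (GLset n)),
      (∀ x : commTuples (2*d) (Uset n), ∃ y : ssTuples (2*d) (GLset n),
        (y : Fin (2*d) → Matrix (Fin n) (Fin n) ℂ) = (x : Fin (2*d) → Matrix (Fin n) (Fin n) ℂ)
          ∧ φ (Quot.mk _ x) = Quot.mk _ y) ∧
      Continuous φ ∧ Function.Injective φ ∧
      IsStrongDeformationRetract (Set.range φ) := by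
  exact ⟨unitaryRepMap (2*d) n, fun x => ⟨Set.inclusion commTuples_Uset_subset x, rfl, rfl⟩,
    continuous_unitaryRepMap _ _, injective_unitaryRepMap _ _,
    isStrongDeformationRetract_range_unitaryRepMap _ _⟩
end

section
/- Fix integers n ≥ 1 and d ≥ 0. The map Hom(ℤ^{2d}, SU(n))/SU(n) → Hom(ℤ^{2d}, SL(n,ℂ))⁺/SL(n,ℂ) induced by the inclusion SU(n) ↪ SL(n,ℂ) is continuous and injective, and its image is a strong deformation retract of Hom(ℤ^{2d}, SL(n,ℂ))⁺/SL(n,ℂ). -/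
open Matrix

open Topology

section SimultaneousDiagonalization

variable {n m : ℕ}

/-- The tuple `μ` of `n`-tuples lists the joint eigenvalues of the tuple of matrices `f`, with
multiplicity: every linear combination of the `f i` has the expected characteristic polynomial. -/
def HasJointSpectrum (f : Fin m → Matrix (Fin n) (Fin n) ℂ) (μ : Fin m → Fin n → ℂ) : Prop :=
  ∀ (z : ℂ) (c : Fin m → ℂ),
    (z • (1 : Matrix (Fin n) (Fin n) ℂ) - ∑ i, c i • f i).det = ∏ j, (z - ∑ i, c i * μ i j)

lemma hasJointSpectrum_diagonal (μ : Fin m → Fin n → ℂ) :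
    HasJointSpectrum (fun i => diagonal (μ i)) μ := by
  intro z c
  have h : z • (1 : Matrix (Fin n) (Fin n) ℂ) - ∑ i, c i • diagonal (μ i)
      = diagonal (fun j => z - ∑ i, c i * μ i j) := by
    ext a b
    rcases eq_or_ne a b with rfl | h
    · simp [Matrix.sum_apply]
    · simp [Matrix.sum_apply, h]
  rw [h, det_diagonal]

lemma HasJointSpectrum.conj {f g : Fin m → Matrix (Fin n) (Fin n) ℂ} {μ : Fin m → Fin n → ℂ}
    (hf : HasJointSpectrum f μ) {P Q : Matrix (Fin n) (Fin n) ℂ} (hPQ : P * Q = 1)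
    (hg : ∀ i, g i = P * f i * Q) : HasJointSpectrum g μ := by
  intro z c
  have h : z • (1 : Matrix (Fin n) (Fin n) ℂ) - ∑ i, c i • g i
      = P * (z • (1 : Matrix (Fin n) (Fin n) ℂ) - ∑ i, c i • f i) * Q := by
    rw [mul_sub, sub_mul, Finset.mul_sum, Finset.sum_mul]
    simp [hg, hPQ]
  rw [h, det_mul, det_mul, hf, mul_right_comm, ← det_mul, hPQ, det_one, one_mul]

lemma HasJointSpectrum.comp_perm {f : Fin m → Matrix (Fin n) (Fin n) ℂ}
    {μ ν : Fin m → Fin n → ℂ} (hf : HasJointSpectrum f ν) (σ : Equiv.Perm (Fin n))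
    (hσ : ∀ i j, μ i j = ν i (σ j)) : HasJointSpectrum f μ := by
  intro z c
  simp only [hσ]
  rw [hf z c, Equiv.prod_comp σ fun j => z - ∑ i, c i * ν i j]

lemma HasJointSpectrum.mem_spectrum {f : Fin m → Matrix (Fin n) (Fin n) ℂ}
    {μ : Fin m → Fin n → ℂ} (hf : HasJointSpectrum f μ) (i : Fin m) (j : Fin n) :
    μ i j ∈ spectrum ℂ (f i) := by
  have h : (μ i j • (1 : Matrix (Fin n) (Fin n) ℂ) - f i).det = 0 := by
    have h1 := hf (μ i j) (Pi.single i 1)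
    simp only [Pi.single_apply, ite_smul, one_smul, zero_smul, ite_mul, one_mul, zero_mul,
      Finset.sum_ite_eq', Finset.mem_univ, if_true] at h1
    rw [h1]
    exact Finset.prod_eq_zero (Finset.mem_univ j) (sub_self _)
  rw [spectrum.mem_iff, isUnit_iff_isUnit_det, Algebra.algebraMap_eq_smul_one, h]
  exact not_isUnit_zero

/-- Two lists of joint eigenvalues of the same tuple agree up to a permutation. -/
lemma HasJointSpectrum.exists_perm {f : Fin m → Matrix (Fin n) (Fin n) ℂ}
    {μ ν : Fin m → Fin n → ℂ} (hμ : HasJointSpectrum f μ) (hν : HasJointSpectrum f ν) :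
    ∃ σ : Equiv.Perm (Fin n), ∀ i j, μ i j = ν i (σ j) := by
  let ι := {p : Fin n × Fin n // (fun i => μ i p.1) - (fun i => ν i p.2) ≠ 0}
  obtain ⟨φ, hφ⟩ := Module.exists_dual_forall_apply_ne_zero (K := ℂ)
    (fun p : ι => (fun i => μ i p.1.1) - (fun i => ν i p.1.2)) (fun p => p.2)
  let c : Fin m → ℂ := fun i => φ (Pi.single i 1)
  have hφc : ∀ v : Fin m → ℂ, φ v = ∑ i, c i * v i := by
    intro v
    rw [LinearMap.pi_apply_eq_sum_univ φ v]
    refine Finset.sum_congr rfl fun i _ => ?_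
    rw [smul_eq_mul, mul_comm]
    congr 2
    ext j
    simp [Pi.single_apply, eq_comm]
  have hpoly : ∏ j, (Polynomial.X - Polynomial.C (∑ i, c i * μ i j))
      = ∏ j, (Polynomial.X - Polynomial.C (∑ i, c i * ν i j)) := by
    refine Polynomial.funext fun z => ?_
    simp only [Polynomial.eval_prod, Polynomial.eval_sub, Polynomial.eval_X, Polynomial.eval_C]
    rw [← hμ z c, hν z c]
  have hroots : Finset.univ.val.map (fun j => ∑ i, c i * μ i j)
      = Finset.univ.val.map (fun j => ∑ i, c i * ν i j) := by
    have h := congrArg Polynomial.roots hpoly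
    rw [Finset.prod_eq_multiset_prod, Finset.prod_eq_multiset_prod] at h
    have key : ∀ g : Fin n → ℂ,
        (Finset.univ.val.map fun j => Polynomial.X - Polynomial.C (g j)).prod.roots
          = Finset.univ.val.map g := by
      intro g
      rw [← Polynomial.roots_multiset_prod_X_sub_C (Finset.univ.val.map g), Multiset.map_map]
      rfl
    rwa [key, key] at h
  obtain ⟨σ, hσ⟩ : ∃ σ : Equiv.Perm (Fin n),
      ∀ j, ∑ i, c i * μ i j = ∑ i, c i * ν i (σ j) := by
    classical
    have hcard : ∀ a : ℂ, Nonempty ({j // ∑ i, c i * μ i j = a} ≃ {j // ∑ i, c i * ν i j = a}) := by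
      intro a
      rw [← Fintype.card_eq, Fintype.card_subtype, Fintype.card_subtype]
      have h := congrArg (Multiset.count a) hroots
      rw [Multiset.count_map, Multiset.count_map] at h
      simpa [Finset.card_def, Finset.filter_val, eq_comm] using h
    let e := fun a => (hcard a).some
    exact ⟨Equiv.ofFiberEquiv e, fun j => (Equiv.ofFiberEquiv_map e j).symm⟩
  refine ⟨σ, fun i j => ?_⟩
  by_contra hne
  refine hφ ⟨(j, σ j), fun h => hne ?_⟩ ?_
  · exact sub_eq_zero.mp (congrFun h i)
  · rw [map_sub, hφc, hφc, sub_eq_zero]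
    exact hσ j

lemma isSemisimple_toLin'_of_aeval_eq_zero {A : Matrix (Fin n) (Fin n) ℂ} (s : Finset ℂ)
    (hs : Polynomial.aeval A (∏ a ∈ s, (Polynomial.X - Polynomial.C a)) = 0) :
    Module.End.IsSemisimple (toLin' A) := by
  have hsep : (∏ a ∈ s, (Polynomial.X - Polynomial.C a)).Separable :=
    Polynomial.separable_prod_X_sub_C_iff'.mpr fun a _ b _ h => h
  refine Module.End.isSemisimple_of_squarefree_aeval_eq_zero hsep.squarefree ?_
  have h := Polynomial.aeval_algHom_apply (toLinAlgEquiv' : _ ≃ₐ[ℂ] _).toAlgHom A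
    (∏ a ∈ s, (Polynomial.X - Polynomial.C a))
  rw [hs, map_zero] at h
  exact h

lemma isSemisimple_toLin'_of_isSemisimpleMat {A : Matrix (Fin n) (Fin n) ℂ}
    (hA : IsSemisimpleMat A) : Module.End.IsSemisimple (toLin' A) := by
  obtain ⟨P, Q, hPQ, hQP, hD⟩ := hA
  obtain ⟨d, hd⟩ : ∃ d, Q * A * P = diagonal d := ⟨_, hD.diagonal_diag.symm⟩
  have hAP : A * P = P * diagonal d := by
    rw [← hd, ← mul_assoc, ← mul_assoc, hPQ, one_mul]
  have key : ∀ p : Polynomial ℂ,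
      Polynomial.aeval A p * P = P * diagonal (fun j => p.eval (d j)) := by
    intro p
    induction p using Polynomial.induction_on' with
    | add p q hp hq =>
      rw [map_add, add_mul, hp, hq, ← mul_add, diagonal_add]
      simp
    | monomial k a =>
      have hpow : A ^ k * P = P * diagonal d ^ k := (SemiconjBy.pow_right (a := P) hAP.symm k).symm
      simp only [Polynomial.aeval_monomial, Polynomial.eval_monomial, mul_assoc, hpow]
      rw [diagonal_pow, ← mul_assoc, Algebra.commutes, mul_assoc, algebraMap_eq_diagonal,
        diagonal_mul_diagonal]
      simp
  refine isSemisimple_toLin'_of_aeval_eq_zero (Finset.univ.image d) ?_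
  have h := key (∏ a ∈ Finset.univ.image d, (Polynomial.X - Polynomial.C a))
  have h0 : (fun j => (∏ a ∈ Finset.univ.image d,
      (Polynomial.X - Polynomial.C a)).eval (d j)) = fun _ => 0 := by
    ext j
    rw [Polynomial.eval_prod]
    exact Finset.prod_eq_zero (Finset.mem_image_of_mem d (Finset.mem_univ j)) (by simp)
  rw [h0, diagonal_zero, mul_zero] at h
  rw [← mul_one (Polynomial.aeval A _), ← hPQ, ← mul_assoc, h, zero_mul]

open scoped Matrix.Norms.L2Operator in
lemma isSemisimple_toLin'_of_mem_unitaryGroup {A : Matrix (Fin n) (Fin n) ℂ}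
    (hA : A ∈ unitaryGroup (Fin n) ℂ) : Module.End.IsSemisimple (toLin' A) := by
  have hnormal : IsStarNormal A := by
    constructor
    change star A * A = A * star A
    rw [mem_unitaryGroup_iff'.mp hA, mem_unitaryGroup_iff.mp hA]
  have hfin : (spectrum ℂ A).Finite := finite_spectrum A
  refine isSemisimple_toLin'_of_aeval_eq_zero hfin.toFinset ?_
  rw [← cfc_polynomial _ A]
  have h0 : Set.EqOn (fun z => (∏ a ∈ hfin.toFinset,
      (Polynomial.X - Polynomial.C a)).eval z) (fun _ => (0 : ℂ)) (spectrum ℂ A) := by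
    intro z hz
    simp only [Polynomial.eval_prod]
    exact Finset.prod_eq_zero (hfin.mem_toFinset.mpr hz) (by simp)
  rw [cfc_congr h0, cfc_const_zero]

lemma exists_simultaneous_diagonalization (f : Fin m → Matrix (Fin n) (Fin n) ℂ)
    (hcomm : ∀ i j, f i * f j = f j * f i)
    (hss : ∀ i, Module.End.IsSemisimple (toLin' (f i))) :
    ∃ (P Q : Matrix (Fin n) (Fin n) ℂ) (μ : Fin m → Fin n → ℂ), P * Q = 1 ∧ Q * P = 1 ∧
      ∀ i, f i = P * diagonal (μ i) * Q := by
  have htop := Module.End.iSup_iInf_maxGenEigenspace_eq_top_of_iSup_maxGenEigenspace_eq_top_of_commute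
    (fun i => toLin' (f i))
    (fun i j _ => by
      change toLin' (f i) * toLin' (f j) = toLin' (f j) * toLin' (f i)
      rw [Module.End.mul_eq_comp, Module.End.mul_eq_comp, ← toLin'_mul, ← toLin'_mul, hcomm])
    (fun i => Module.End.iSup_maxGenEigenspace_eq_top _)
  simp only [(hss _).isFinitelySemisimple.maxGenEigenspace_eq_eigenspace] at htop
  let s : Set (Fin n → ℂ) := {v | ∃ χ : Fin m → ℂ, ∀ i, f i *ᵥ v = χ i • v}
  have hs : ⊤ ≤ Submodule.span ℂ s := by
    rw [← htop]
    refine iSup_le fun χ v hv => Submodule.subset_span ⟨χ, fun i => ?_⟩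
    rw [Submodule.mem_iInf] at hv
    simpa [Module.End.mem_eigenspace_iff] using hv i
  let b₀ := Module.Basis.ofSpan hs
  have : Fintype _ := FiniteDimensional.fintypeBasisIndex b₀
  let e := Fintype.equivFinOfCardEq ((Module.finrank_eq_card_basis b₀).symm.trans (by simp) :
    _ = n)
  let b := b₀.reindex e
  have hb : ∀ j, ∃ χ : Fin m → ℂ, ∀ i, f i *ᵥ b j = χ i • b j := by
    intro j
    have : b j ∈ s := by
      rw [Module.Basis.reindex_apply]
      exact Module.Basis.ofSpan_subset hs ⟨_, rfl⟩
    exact this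
  choose χ hχ using hb
  let P : Matrix (Fin n) (Fin n) ℂ := of fun a j => b j a
  have hP : P = (Pi.basisFun ℂ (Fin n)).toMatrix b := by
    ext a j
    simp [P, Module.Basis.toMatrix_apply]
  have hPQ := Module.Basis.toMatrix_mul_toMatrix_flip (Pi.basisFun ℂ (Fin n)) b
  have hQP := Module.Basis.toMatrix_mul_toMatrix_flip b (Pi.basisFun ℂ (Fin n))
  rw [← hP] at hPQ hQP
  refine ⟨P, _, fun i j => χ j i, hPQ, hQP, fun i => ?_⟩
  have h : f i * P = P * diagonal (fun j => χ j i) := by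
    ext a j
    rw [mul_diagonal, mul_comm (P a j)]
    exact congrFun (hχ j i) a
  rw [← h, mul_assoc, hPQ, mul_one]

/-- A commuting tuple of semisimple matrices is conjugate to the diagonal tuple formed from any list
of its joint eigenvalues. -/
lemma exists_conj_diagonal {f : Fin m → Matrix (Fin n) (Fin n) ℂ}
    (hcomm : ∀ i j, f i * f j = f j * f i)
    (hss : ∀ i, Module.End.IsSemisimple (toLin' (f i)))
    {μ : Fin m → Fin n → ℂ} (hμ : HasJointSpectrum f μ) :
    ∃ P Q : Matrix (Fin n) (Fin n) ℂ, P * Q = 1 ∧ ∀ i, P * f i * Q = diagonal (μ i) := by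
  obtain ⟨P, Q, ν, hPQ, hQP, hf⟩ := exists_simultaneous_diagonalization f hcomm hss
  obtain ⟨σ, hσ⟩ := hμ.exists_perm ((hasJointSpectrum_diagonal ν).conj hPQ hf)
  refine ⟨Q.submatrix σ id, P.submatrix id σ, ?_, fun i => ?_⟩
  · rw [← submatrix_mul _ _ _ _ _ Function.bijective_id, hQP, submatrix_one_equiv]
  · have h : Q.submatrix σ id * f i * P.submatrix id σ = (Q * f i * P).submatrix σ σ := by
      ext a b
      simp [mul_apply]
    rw [h, hf, ← mul_assoc, ← mul_assoc, hQP, one_mul, mul_assoc, hQP, mul_one,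
      submatrix_diagonal_equiv]
    exact congrArg diagonal (funext fun j => (hσ i j).symm)

end SimultaneousDiagonalization

section Conjugation

variable {n m : ℕ}

/-- Two tuples conjugate by an invertible matrix are conjugate by a matrix of determinant one. -/
lemma exists_det_one_conj (hn : 1 ≤ n) {x y : Fin m → Matrix (Fin n) (Fin n) ℂ}
    {g g' : Matrix (Fin n) (Fin n) ℂ} (h : g * g' = 1) (hxy : ∀ i, g * x i * g' = y i) :
    ∃ u v : Matrix (Fin n) (Fin n) ℂ, u.det = 1 ∧ v.det = 1 ∧ u * v = 1 ∧ v * u = 1 ∧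
      ∀ i, u * x i * v = y i := by
  have hdet : g.det * g'.det = 1 := by rw [← det_mul, h, det_one]
  obtain ⟨s, hs⟩ := IsAlgClosed.exists_pow_nat_eq g'.det (show 0 < n by omega)
  have hs0 : s ≠ 0 := by
    rintro rfl
    rw [zero_pow (by omega)] at hs
    simp [← hs] at hdet
  have huv : (s • g) * (s⁻¹ • g') = 1 := by
    rw [smul_mul_smul_comm, mul_inv_cancel₀ hs0, one_smul, h]
  have hu : (s • g).det = 1 := by
    rw [det_smul, Fintype.card_fin, hs, mul_comm, hdet]
  refine ⟨s • g, s⁻¹ • g', hu, ?_, huv, mul_eq_one_comm.mp huv, fun i => ?_⟩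
  · have := congrArg det huv
    rwa [det_mul, hu, one_mul, det_one] at this
  · rw [smul_mul_assoc, smul_mul_smul_comm, mul_inv_cancel₀ hs0, one_smul, hxy]

open scoped ComplexOrder MatrixOrder Matrix.Norms.L2Operator in
/-- If two tuples of unitary matrices are conjugate in `SL(n, ℂ)`, they are conjugate by the
unitary part of the polar decomposition of the conjugating matrix, which lies in `SU(n)`. -/
lemma exists_specialUnitary_conj {x y : Fin m → Matrix (Fin n) (Fin n) ℂ}
    (hx : ∀ i, x i ∈ unitaryGroup (Fin n) ℂ) (hy : ∀ i, y i ∈ unitaryGroup (Fin n) ℂ)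
    {g g' : Matrix (Fin n) (Fin n) ℂ} (hg : g.det = 1) (h : g' * g = 1)
    (hxy : ∀ i, g * x i * g' = y i) :
    ∃ u ∈ SUset n, ∃ v ∈ SUset n, u * v = 1 ∧ v * u = 1 ∧ ∀ i, u * x i * v = y i := by
  have hgx : ∀ i, g * x i = y i * g := fun i => by rw [← hxy, mul_assoc, h, mul_one]
  have hcomm : ∀ i, Commute (star g * g) (x i) := by
    intro i
    have h1 : star (x i) * (star g * g) * x i = star g * g := by
      calc star (x i) * (star g * g) * x i = star (g * x i) * (g * x i) := by
            rw [star_mul]; simp only [mul_assoc]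
        _ = star g * (star (y i) * y i) * g := by
            rw [hgx, star_mul]; simp only [mul_assoc]
        _ = star g * g := by rw [mem_unitaryGroup_iff'.mp (hy i), mul_one]
    change star g * g * x i = x i * (star g * g)
    conv_rhs => rw [← h1, ← mul_assoc, ← mul_assoc, mem_unitaryGroup_iff.mp (hx i), one_mul]
  have hpos : (star g * g).PosSemidef := posSemidef_conjTranspose_mul_self g
  let p := CFC.sqrt (star g * g)
  have hpp : p * p = star g * g := CFC.sqrt_mul_sqrt_self _ hpos.nonneg
  have hpsa : star p = p := (CFC.sqrt_nonneg (star g * g)).isSelfAdjoint.star_eq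
  have hpdet : p.det = 1 := by
    have := hpos.det_sqrt
    rw [det_mul, star_eq_conjTranspose, det_conjTranspose, hg] at this
    simpa [p, star_eq_conjTranspose] using this
  have hpunit : IsUnit p.det := by rw [hpdet]; exact isUnit_one
  have hpx : ∀ i, Commute p (x i) := by
    intro i
    change Commute (CFC.sqrt _) _
    rw [CFC.sqrt_eq_cfc]
    exact (hcomm i).cfc_nnreal _
  have hp1 : p * p⁻¹ = 1 := mul_nonsing_inv p hpunit
  have hp2 : p⁻¹ * p = 1 := nonsing_inv_mul p hpunit
  have hsp : star p⁻¹ = p⁻¹ := by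
    rw [star_eq_conjTranspose, conjTranspose_nonsing_inv, ← star_eq_conjTranspose, hpsa]
  have hu : g * p⁻¹ ∈ unitaryGroup (Fin n) ℂ := by
    rw [mem_unitaryGroup_iff', star_mul, hsp]
    calc p⁻¹ * star g * (g * p⁻¹) = p⁻¹ * (star g * g) * p⁻¹ := by simp only [mul_assoc]
      _ = 1 := by rw [← hpp, ← mul_assoc, hp2, one_mul, hp1]
  have hudet : (g * p⁻¹).det = 1 := by
    have := congrArg det hp1
    rw [det_mul, hpdet, one_mul, det_one] at this
    rw [det_mul, hg, this, one_mul]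
  refine ⟨g * p⁻¹, ⟨hu, hudet⟩, star (g * p⁻¹), ⟨Unitary.star_mem hu, ?_⟩,
    mem_unitaryGroup_iff.mp hu, mem_unitaryGroup_iff'.mp hu, fun i => ?_⟩
  · rw [star_eq_conjTranspose, det_conjTranspose, hudet, star_one]
  · have h1 : g * p⁻¹ * x i = y i * (g * p⁻¹) := by
      have h2 : p⁻¹ * x i = x i * p⁻¹ := by
        calc p⁻¹ * x i = p⁻¹ * (x i * p) * p⁻¹ := by
              rw [mul_assoc, mul_assoc, hp1, mul_one]
          _ = x i * p⁻¹ := by rw [← (hpx i).eq, ← mul_assoc, hp2, one_mul]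
      rw [mul_assoc, h2, ← mul_assoc, hgx, mul_assoc]
    rw [h1, mul_assoc, mem_unitaryGroup_iff.mp hu, mul_one]

end Conjugation

section RadialRetraction

variable {n m : ℕ}

/-- The `m`-tuples of diagonal entries of matrices in the diagonal torus of `SL(n, ℂ)`. -/
def torusTuples (m n : ℕ) : Set (Fin m → Fin n → ℂ) := {μ | ∀ i, ∏ j, μ i j = 1}

lemma isClosed_torusTuples : IsClosed (torusTuples m n) := by
  simp only [torusTuples, Set.ofPred_forall]
  exact isClosed_iInter fun i => isClosed_eq (by fun_prop) continuous_const

lemma ne_zero_of_mem_torusTuples {μ : Fin m → Fin n → ℂ} (hμ : μ ∈ torusTuples m n)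
    (i : Fin m) (j : Fin n) : μ i j ≠ 0 :=
  fun h => one_ne_zero ((hμ i).symm.trans (Finset.prod_eq_zero (Finset.mem_univ j) h))

lemma isSemisimpleMat_of_conj_diagonal {A P Q : Matrix (Fin n) (Fin n) ℂ} {d : Fin n → ℂ}
    (hPQ : P * Q = 1) (hA : P * A * Q = diagonal d) : IsSemisimpleMat A :=
  ⟨Q, P, mul_eq_one_comm.mp hPQ, hPQ, hA ▸ isDiag_diagonal d⟩

/-- The tuple of diagonal matrices with given diagonals. -/
def diagonalTuple (μ : torusTuples m n) : ssTuples m (SLset n) :=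
  ⟨fun i => diagonal (μ.1 i),
    ⟨⟨fun i => (det_diagonal).trans (μ.2 i), fun i j => by
      simp only [diagonal_mul_diagonal, mul_comm]⟩,
    fun _ => isSemisimpleMat_of_conj_diagonal (one_mul 1) (by rw [one_mul, mul_one])⟩⟩

/-- The conjugacy class of the tuple of diagonal matrices with given diagonals. -/
def diagonalClass (μ : torusTuples m n) : RepSpace (SLset n) (ssTuples m (SLset n)) :=
  Quot.mk _ (diagonalTuple μ)

lemma continuous_diagonalClass : Continuous (diagonalClass (m := m) (n := n)) := by
  refine continuous_quot_mk.comp (Continuous.subtype_mk (continuous_pi fun i => ?_) _)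
  exact ((continuous_apply i).comp continuous_subtype_val).matrix_diagonal

lemma conjRel_of_mk_eq {x y : ssTuples m (SLset n)}
    (h : (Quot.mk _ x : RepSpace (SLset n) (ssTuples m (SLset n))) = Quot.mk _ y) :
    conjRel (SLset n) _ x y := by
  rw [Quot.eq] at h
  induction h with
  | rel x y h => exact h
  | refl x =>
    exact ⟨1, 1, det_one, det_one, one_mul 1, one_mul 1, fun i => by rw [one_mul, mul_one]⟩
  | symm x y _ ih =>
    obtain ⟨g, g', hg, hg', h1, h2, h3⟩ := ih
    refine ⟨g', g, hg', hg, h2, h1, fun i => ?_⟩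
    rw [← h3, ← mul_assoc, ← mul_assoc, h2, one_mul, mul_assoc, h2, mul_one]
  | trans x y z _ _ ih1 ih2 =>
    obtain ⟨g, g', hg, hg', h1, h2, h3⟩ := ih1
    obtain ⟨k, k', hk, hk', l1, l2, l3⟩ := ih2
    refine ⟨k * g, g' * k', ?_, ?_, ?_, ?_, fun i => ?_⟩
    · exact (det_mul k g).trans (by rw [hk, hg, one_mul])
    · exact (det_mul g' k').trans (by rw [hg', hk', one_mul])
    · rw [mul_assoc, ← mul_assoc g, h1, one_mul, l1]
    · rw [mul_assoc, ← mul_assoc k', l2, one_mul, h2]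
    · rw [← l3, ← h3]
      simp only [mul_assoc]

lemma mk_eq_diagonalClass_iff (hn : 1 ≤ n) (x : ssTuples m (SLset n)) (μ : torusTuples m n) :
    Quot.mk _ x = diagonalClass μ ↔ HasJointSpectrum x.1 μ.1 := by
  constructor
  · intro h
    obtain ⟨g, g', -, -, h1, -, h3⟩ := conjRel_of_mk_eq h.symm
    exact (hasJointSpectrum_diagonal μ.1).conj h1 fun i => (h3 i).symm
  · intro h
    obtain ⟨P, Q, hPQ, hf⟩ := exists_conj_diagonal x.2.1.2
      (fun i => isSemisimple_toLin'_of_isSemisimpleMat (x.2.2 i)) h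
    obtain ⟨u, v, hu, hv, huv, hvu, hxy⟩ := exists_det_one_conj hn hPQ hf
    exact Quot.sound ⟨u, v, hu, hv, huv, hvu, hxy⟩

lemma exists_hasJointSpectrum (x : ssTuples m (SLset n)) :
    ∃ μ : torusTuples m n, HasJointSpectrum x.1 μ.1 := by
  obtain ⟨P, Q, μ, hPQ, -, hf⟩ := exists_simultaneous_diagonalization x.1 x.2.1.2
    (fun i => isSemisimple_toLin'_of_isSemisimpleMat (x.2.2 i))
  refine ⟨⟨μ, fun i => ?_⟩, (hasJointSpectrum_diagonal μ).conj hPQ hf⟩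
  have h : (x.1 i).det = 1 := x.2.1.1 i
  rwa [hf, det_mul, det_mul, mul_right_comm, ← det_mul, hPQ, det_one, one_mul,
    det_diagonal] at h

lemma surjective_diagonalClass (hn : 1 ≤ n) :
    Function.Surjective (diagonalClass (m := m) (n := n)) := by
  rintro ⟨x⟩
  obtain ⟨μ, hμ⟩ := exists_hasJointSpectrum x
  exact ⟨μ, ((mk_eq_diagonalClass_iff hn x μ).mpr hμ).symm⟩

lemma isClosed_setOf_hasJointSpectrum :
    IsClosed {p : (Fin m → Matrix (Fin n) (Fin n) ℂ) × (Fin m → Fin n → ℂ) |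
      HasJointSpectrum p.1 p.2} := by
  simp only [HasJointSpectrum, Set.ofPred_forall]
  refine isClosed_iInter fun z => isClosed_iInter fun c => isClosed_eq ?_ (by fun_prop)
  exact Continuous.matrix_det (by fun_prop)

open scoped Matrix.Norms.L2Operator in
/-- Joint eigenvalues are bounded by the norms of the matrices, so that the class map on the
diagonal torus is closed. -/
lemma isClosedMap_diagonalClass (hn : 1 ≤ n) :
    IsClosedMap (diagonalClass (m := m) (n := n)) := by
  intro C hC
  rw [← isQuotientMap_quot_mk.isClosed_preimage, isClosed_iff_ultrafilter]
  intro x u hux hu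
  have hex : ∀ y : ssTuples m (SLset n), ∃ μ : Fin m → Fin n → ℂ,
      Quot.mk _ y ∈ diagonalClass '' C → μ ∈ Subtype.val '' C ∧ HasJointSpectrum y.1 μ := by
    intro y
    by_cases hy : Quot.mk _ y ∈ diagonalClass '' C
    · obtain ⟨μ, hμ, h⟩ := hy
      exact ⟨μ, fun _ => ⟨⟨μ, hμ, rfl⟩, (mk_eq_diagonalClass_iff hn y μ).mp h.symm⟩⟩
    · exact ⟨0, fun h => absurd h hy⟩
  choose ν hν using hex
  have hνu : ∀ᶠ y in (u : Filter (ssTuples m (SLset n))),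
      ν y ∈ Subtype.val '' C ∧ HasJointSpectrum y.1 (ν y) :=
    Filter.mem_of_superset hu fun y hy => hν y hy
  have hbound : ∀ᶠ y in (u : Filter (ssTuples m (SLset n))), ∀ i,
      ‖y.1 i‖ * ‖(1 : Matrix (Fin n) (Fin n) ℂ)‖ <
        ‖x.1 i‖ * ‖(1 : Matrix (Fin n) (Fin n) ℂ)‖ + 1 := by
    rw [Filter.eventually_all]
    intro i
    have hcont : Continuous fun y : ssTuples m (SLset n) =>
        ‖y.1 i‖ * ‖(1 : Matrix (Fin n) (Fin n) ℂ)‖ :=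
      ((continuous_apply i).comp continuous_subtype_val).norm.mul continuous_const
    exact hux ((hcont.tendsto x).eventually_lt_const (lt_add_one _))
  let K : Set (Fin m → Fin n → ℂ) := Set.univ.pi fun i => Set.univ.pi fun _ =>
    Metric.closedBall 0 (‖x.1 i‖ * ‖(1 : Matrix (Fin n) (Fin n) ℂ)‖ + 1)
  have hK : IsCompact K := isCompact_univ_pi fun i => isCompact_univ_pi fun _ =>
    isCompact_closedBall _ _
  have hνK : ∀ᶠ y in (u : Filter (ssTuples m (SLset n))), ν y ∈ K := by
    filter_upwards [hνu, hbound] with y hy hb i _ j _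
    rw [mem_closedBall_zero_iff]
    exact (spectrum.norm_le_norm_mul_of_mem (hy.2.mem_spectrum i j)).trans (hb i).le
  obtain ⟨μ, -, hμ⟩ := hK.ultrafilter_le_nhds (u.map ν)
    (by rw [Filter.le_principal_iff]; exact hνK)
  have hμC : μ ∈ Subtype.val '' C :=
    (isClosed_torusTuples.isClosedEmbedding_subtypeVal.isClosedMap C hC).mem_of_tendsto hμ
      (hνu.mono fun y hy => hy.1)
  obtain ⟨μ, hμC, rfl⟩ := hμC
  refine ⟨μ, hμC, ((mk_eq_diagonalClass_iff hn x μ).mpr ?_).symm⟩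
  exact isClosed_setOf_hasJointSpectrum.mem_of_tendsto
    (((continuous_subtype_val.tendsto x).mono_left hux).prodMk_nhds hμ)
    (hνu.mono fun y hy => hy.2)

lemma isQuotientMap_diagonalClass (hn : 1 ≤ n) :
    IsQuotientMap (diagonalClass (m := m) (n := n)) :=
  (isClosedMap_diagonalClass hn).isQuotientMap continuous_diagonalClass
    (surjective_diagonalClass hn)

/-- The radial flow `z ↦ z * |z| ^ (-t)` on the diagonal torus, moving it at time `1` into the
compact torus. -/
noncomputable def radialFlow (t : ℝ) (μ : torusTuples m n) : torusTuples m n :=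
  ⟨fun i j => μ.1 i j * (‖μ.1 i j‖ ^ (-t) : ℝ), fun i => by
    rw [Finset.prod_mul_distrib, μ.2 i, one_mul, ← Complex.ofReal_prod,
      Real.finsetProd_rpow _ _ fun j _ => norm_nonneg _, ← norm_prod, μ.2 i, norm_one,
      Real.one_rpow, Complex.ofReal_one]⟩

lemma continuous_radialFlow :
    Continuous fun p : torusTuples m n × unitInterval => radialFlow p.2 p.1 := by
  refine Continuous.subtype_mk (continuous_pi fun i => continuous_pi fun j => ?_) _
  have h : Continuous fun p : torusTuples m n × unitInterval => p.1.1 i j :=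
    ((continuous_apply_apply i j).comp continuous_subtype_val).comp continuous_fst
  refine h.mul (Complex.continuous_ofReal.comp ?_)
  exact h.norm.rpow (by fun_prop)
    fun p => Or.inl (norm_ne_zero_iff.mpr (ne_zero_of_mem_torusTuples p.1.2 i j))

lemma radialFlow_zero (μ : torusTuples m n) : radialFlow 0 μ = μ := by
  ext i j
  simp [radialFlow]

lemma norm_radialFlow_one (μ : torusTuples m n) (i : Fin m) (j : Fin n) :
    ‖(radialFlow 1 μ).1 i j‖ = 1 := by
  have h := norm_ne_zero_iff.mpr (ne_zero_of_mem_torusTuples μ.2 i j)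
  simp [radialFlow, Real.rpow_neg_one, h]

lemma radialFlow_of_norm_eq_one {μ : torusTuples m n} (h : ∀ i j, ‖μ.1 i j‖ = 1) (t : ℝ) :
    radialFlow t μ = μ := by
  ext i j
  simp [radialFlow, h]

lemma diagonalClass_radialFlow_congr (hn : 1 ≤ n) {μ ν : torusTuples m n}
    (h : diagonalClass μ = diagonalClass ν) (t : ℝ) :
    diagonalClass (radialFlow t μ) = diagonalClass (radialFlow t ν) := by
  obtain ⟨σ, hσ⟩ := ((mk_eq_diagonalClass_iff hn _ ν).mp h).exists_perm
    (hasJointSpectrum_diagonal μ.1)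
  refine (mk_eq_diagonalClass_iff hn _ _).mpr
    ((hasJointSpectrum_diagonal (radialFlow t μ).1).comp_perm σ fun i j => ?_)
  simp [radialFlow, hσ]

lemma mem_unitaryGroup_diagonal {d : Fin n → ℂ} (hd : ∀ j, ‖d j‖ = 1) :
    diagonal d ∈ unitaryGroup (Fin n) ℂ := by
  rw [mem_unitaryGroup_iff, star_eq_conjTranspose, diagonal_conjTranspose, diagonal_mul_diagonal,
    ← diagonal_one]
  congr 1
  ext j
  simp [Complex.mul_conj, Complex.normSq_eq_norm_sq, hd]

lemma mem_ssTuples_of_mem_commTuples {f : Fin m → Matrix (Fin n) (Fin n) ℂ}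
    (hf : f ∈ commTuples m (SUset n)) : f ∈ ssTuples m (SLset n) := by
  refine ⟨⟨fun i => (hf.1 i).2, hf.2⟩, fun i => ?_⟩
  obtain ⟨P, Q, μ, hPQ, hQP, h⟩ := exists_simultaneous_diagonalization f hf.2
    fun i => isSemisimple_toLin'_of_mem_unitaryGroup (hf.1 i).1
  refine isSemisimpleMat_of_conj_diagonal (d := μ i) hQP ?_
  rw [h, ← mul_assoc, ← mul_assoc, hQP, one_mul, mul_assoc, hQP, mul_one]

open scoped Matrix.Norms.L2Operator in
lemma HasJointSpectrum.norm_eq_one {f : Fin m → Matrix (Fin n) (Fin n) ℂ}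
    {μ : Fin m → Fin n → ℂ} (hf : HasJointSpectrum f μ)
    (hu : ∀ i, f i ∈ unitaryGroup (Fin n) ℂ) (i : Fin m) (j : Fin n) : ‖μ i j‖ = 1 :=
  mem_sphere_zero_iff_norm.mp
    (spectrum.subset_circle_of_unitary (𝕜 := ℂ) (hu i) (hf.mem_spectrum i j))

/-- The inclusion of commuting tuples in `SU(n)` into semisimple commuting tuples in
`SL(n, ℂ)`. -/
def specialUnitaryInclusion (x : commTuples m (SUset n)) : ssTuples m (SLset n) :=
  ⟨x.1, mem_ssTuples_of_mem_commTuples x.2⟩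

/-- The map of orbit spaces induced by the inclusion of `SU(n)` into `SL(n, ℂ)`. -/
def repSpaceMap : RepSpace (SUset n) (commTuples m (SUset n)) →
    RepSpace (SLset n) (ssTuples m (SLset n)) :=
  Quot.map specialUnitaryInclusion fun _ _ ⟨g, g', hg, hg', h⟩ => ⟨g, g', hg.2, hg'.2, h⟩

lemma continuous_repSpaceMap : Continuous (repSpaceMap (m := m) (n := n)) :=
  continuous_quot_lift _ (continuous_quot_mk.comp (continuous_subtype_val.subtype_mk _))

lemma injective_repSpaceMap : Function.Injective (repSpaceMap (m := m) (n := n)) := by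
  rintro ⟨x⟩ ⟨y⟩ h
  obtain ⟨g, g', hg, -, -, h2, h3⟩ := conjRel_of_mk_eq h
  obtain ⟨u, hu, v, hv, huv, hvu, hxy⟩ := exists_specialUnitary_conj
    (fun i => (x.2.1 i).1) (fun i => (y.2.1 i).1) hg h2 h3
  exact Quot.sound ⟨u, v, hu, hv, huv, hvu, hxy⟩

lemma diagonalClass_mem_range_repSpaceMap {μ : torusTuples m n} (h : ∀ i j, ‖μ.1 i j‖ = 1) :
    diagonalClass μ ∈ Set.range (repSpaceMap (m := m) (n := n)) :=
  ⟨Quot.mk _ ⟨(diagonalTuple μ).1,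
    fun i => ⟨mem_unitaryGroup_diagonal (h i), (diagonalTuple μ).2.1.1 i⟩,
    (diagonalTuple μ).2.1.2⟩, rfl⟩

lemma exists_norm_eq_one_of_mem_range_repSpaceMap (hn : 1 ≤ n)
    {a : RepSpace (SLset n) (ssTuples m (SLset n))} (ha : a ∈ Set.range repSpaceMap) :
    ∃ μ : torusTuples m n, diagonalClass μ = a ∧ ∀ i j, ‖μ.1 i j‖ = 1 := by
  obtain ⟨⟨x⟩, rfl⟩ := ha
  obtain ⟨μ, hμ⟩ := exists_hasJointSpectrum (specialUnitaryInclusion x)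
  exact ⟨μ, ((mk_eq_diagonalClass_iff hn _ μ).mpr hμ).symm,
    hμ.norm_eq_one fun i => (x.2.1 i).1⟩

lemma isStrongDeformationRetract_range_repSpaceMap (hn : 1 ≤ n) :
    IsStrongDeformationRetract (Set.range (repSpaceMap (m := m) (n := n))) := by
  let r := Function.surjInv (surjective_diagonalClass (m := m) hn)
  have hr : ∀ a, diagonalClass (r a) = a := Function.surjInv_eq _
  have hflow : ∀ (μ : torusTuples m n) (t : ℝ),
      diagonalClass (radialFlow t (r (diagonalClass μ))) = diagonalClass (radialFlow t μ) :=
    fun μ t => diagonalClass_radialFlow_congr hn (hr _) t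
  refine ⟨fun p => diagonalClass (radialFlow p.2 (r p.1)), ?_, fun a => ?_, fun a => ?_,
    fun a ha t => ?_⟩
  · refine (isQuotientMap_diagonalClass hn).continuous_lift_prod_left ?_
    simp only [hflow]
    exact continuous_diagonalClass.comp continuous_radialFlow
  · simp only [Set.Icc.coe_zero, radialFlow_zero, hr]
  · exact diagonalClass_mem_range_repSpaceMap (norm_radialFlow_one _)
  · obtain ⟨μ, rfl, hμ⟩ := exists_norm_eq_one_of_mem_range_repSpaceMap hn ha
    simp only [hflow, radialFlow_of_norm_eq_one hμ]

end RadialRetraction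

/-- Theorem 4.3 of Biswas–Florentino for `G = SL(n,ℂ)`, `K = SU(n)`:
the map `Hom(ℤ^{2d},SU(n))/SU(n) → Hom(ℤ^{2d},SL(n,ℂ))⁺/SL(n,ℂ)` induced by the
inclusion `SU(n) ↪ SL(n,ℂ)` is continuous and injective, and its image is a strong
deformation retract of `Hom(ℤ^{2d},SL(n,ℂ))⁺/SL(n,ℂ)`. -/
theorem commuting_tuples_specialUnitary_retract_of_specialLinear (n d : ℕ) (hn : 1 ≤ n) :
    ∃ φ : RepSpace (SUset n) (commTuples (2*d) (SUset n)) →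
          RepSpace (SLset n) (ssTuples (2*d) (SLset n)),
      (∀ x : commTuples (2*d) (SUset n), ∃ y : ssTuples (2*d) (SLset n),
        (y : Fin (2*d) → Matrix (Fin n) (Fin n) ℂ) = (x : Fin (2*d) → Matrix (Fin n) (Fin n) ℂ)
          ∧ φ (Quot.mk _ x) = Quot.mk _ y) ∧
      Continuous φ ∧ Function.Injective φ ∧
      IsStrongDeformationRetract (Set.range φ) := by
  exact ⟨repSpaceMap, fun x => ⟨specialUnitaryInclusion x, rfl, rfl⟩, continuous_repSpaceMap,
    injective_repSpaceMap, isStrongDeformationRetract_range_repSpaceMap hn⟩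
end

section
/- Fix integers n ≥ 1 and d ≥ 0. The spaces Hom(ℤ^{2d}, GL(n,ℂ))⁺/GL(n,ℂ) and Hom(ℤ^{2d}, U(n))/U(n) are homotopy equivalent. -/
open Matrix

/-- `z` lists, with multiplicity, the joint eigenvalues of the tuple `A`, which is
simultaneously diagonalizable. -/
def IsJointSpectrum {m n : ℕ} (A : Fin m → Matrix (Fin n) (Fin n) ℂ)
    (z : Fin n → Fin m → ℂ) : Prop :=
  ∃ P Pi : Matrix (Fin n) (Fin n) ℂ, P * Pi = 1 ∧ Pi * P = 1 ∧
    ∀ j, Pi * A j * P = diagonal fun k => z k j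

/-- The tuple of diagonal matrices with joint spectrum `z`. -/
def diagTuple {m n : ℕ} (z : Fin n → Fin m → ℂ) : Fin m → Matrix (Fin n) (Fin n) ℂ :=
  fun j => diagonal fun k => z k j

theorem isJointSpectrum_diagTuple {m n : ℕ} (z : Fin n → Fin m → ℂ) :
    IsJointSpectrum (diagTuple z) z :=
  ⟨1, 1, by simp, by simp, fun j => by simp [diagTuple]⟩

theorem IsSemisimpleMat.maxGenEigenspace_eq {n : ℕ} {A : Matrix (Fin n) (Fin n) ℂ}
    (hA : IsSemisimpleMat A) (μ : ℂ) :
    Module.End.maxGenEigenspace (toLin' A) μ = Module.End.eigenspace (toLin' A) μ := by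
  obtain ⟨P, Pi, h1, h2, hD⟩ := hA
  obtain ⟨d, hd⟩ : ∃ d, Pi * A * P = diagonal d := ⟨_, (hD.diagonal_diag).symm⟩
  have hAP : ∀ k : ℕ, (A - μ • 1) ^ k = P * diagonal (fun i => (d i - μ) ^ k) * Pi := by
    have h0 : A - μ • 1 = P * diagonal (fun i => d i - μ) * Pi := by
      have : diagonal (fun i => d i - μ) = Pi * A * P - μ • 1 := by
        rw [hd]; ext i j; by_cases h : i = j <;> simp [h]
      rw [this]
      simp only [mul_sub, sub_mul, mul_smul_comm, smul_mul_assoc, mul_one, h1]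
      simp only [← mul_assoc, h1, one_mul]
      simp only [mul_assoc, h1, mul_one]
    intro k
    induction k with
    | zero => simp [h1]
    | succ k ih =>
      rw [pow_succ, ih, h0]
      calc P * diagonal (fun i => (d i - μ) ^ k) * Pi * (P * diagonal (fun i => d i - μ) * Pi)
          = P * diagonal (fun i => (d i - μ) ^ k) * (Pi * P) * diagonal (fun i => d i - μ) * Pi := by
            simp only [mul_assoc]
        _ = _ := by
            rw [h2, mul_one, mul_assoc P, diagonal_mul_diagonal]
            simp only [pow_succ]
  have hpow : ∀ k : ℕ, ((toLin' A) - μ • 1) ^ k = toLin' ((A - μ • 1) ^ k) := by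
    intro k
    rw [Matrix.toLin'_pow]
    congr 1
    simp [Module.End.one_eq_id]
  apply le_antisymm
  · intro v hv
    obtain ⟨k, hk⟩ := Module.End.mem_maxGenEigenspace _ _ _ |>.1 hv
    rw [hpow, hAP, toLin'_apply, ← mulVec_mulVec, ← mulVec_mulVec] at hk
    have hk' : diagonal (fun i => (d i - μ) ^ k) *ᵥ (Pi *ᵥ v) = 0 := by
      have := congrArg (fun u => Pi *ᵥ u) hk
      simpa [mulVec_mulVec, ← mul_assoc, h2] using this
    have h3 : diagonal (fun i => (d i - μ) ^ 1) *ᵥ (Pi *ᵥ v) = 0 := by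
      ext i
      have := congrFun hk' i
      rw [mulVec_diagonal] at this ⊢
      rcases mul_eq_zero.1 this with h | h
      · simp [eq_zero_of_pow_eq_zero h]
      · simp [h]
    have h4 : (A - μ • 1) ^ 1 *ᵥ v = 0 := by
      rw [hAP, ← mulVec_mulVec, ← mulVec_mulVec, h3, mulVec_zero]
    rw [pow_one, sub_mulVec, smul_mulVec, one_mulVec, sub_eq_zero] at h4
    rw [Module.End.mem_eigenspace_iff, toLin'_apply, h4]
  · exact (Module.End.genEigenspace _ _).monotone le_top

theorem exists_isJointSpectrum {m n : ℕ} {A : Fin m → Matrix (Fin n) (Fin n) ℂ}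
    (hc : ∀ i j, A i * A j = A j * A i) (hs : ∀ i, IsSemisimpleMat (A i)) :
    ∃ z, IsJointSpectrum A z := by
  have htop : ⨆ χ : Fin m → ℂ, ⨅ i, Module.End.eigenspace (toLin' (A i)) (χ i) = ⊤ := by
    simp only [← (hs _).maxGenEigenspace_eq]
    refine Module.End.iSup_iInf_maxGenEigenspace_eq_top_of_iSup_maxGenEigenspace_eq_top_of_commute
      _ (fun i j _ => ?_) fun i => Module.End.iSup_maxGenEigenspace_eq_top _
    change toLin' (A i) * toLin' (A j) = toLin' (A j) * toLin' (A i)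
    rw [Module.End.mul_eq_comp, Module.End.mul_eq_comp, ← toLin'_mul, ← toLin'_mul, hc]
  let s : Set (Fin n → ℂ) := {v | ∃ χ : Fin m → ℂ, ∀ i, A i *ᵥ v = χ i • v}
  have hspan : ⊤ ≤ Submodule.span ℂ s := by
    rw [← htop]
    refine iSup_le fun χ v hv => Submodule.subset_span ⟨χ, fun i => ?_⟩
    simpa using Module.End.mem_eigenspace_iff.1 ((Submodule.mem_iInf _).1 hv i)
  let b := Module.Basis.ofSpan hspan
  have hb : ∀ k, b k ∈ s := fun k => Module.Basis.ofSpan_subset hspan ⟨k, rfl⟩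
  have : Fintype ((linearIndepOn_empty ℂ id).extend (Set.empty_subset s)) :=
    FiniteDimensional.fintypeBasisIndex b
  have e := b.indexEquiv (Pi.basisFun ℂ (Fin n))
  let c := b.reindex e
  choose χ hχ using fun k => (show c k ∈ s by simpa [c] using hb (e.symm k))
  let P := (Pi.basisFun ℂ (Fin n)).toMatrix c
  let Pi' := c.toMatrix (Pi.basisFun ℂ (Fin n))
  have h2 : Pi' * P = 1 := Module.Basis.toMatrix_mul_toMatrix_flip _ _
  refine ⟨χ, P, Pi', Module.Basis.toMatrix_mul_toMatrix_flip _ _, h2, fun j => ?_⟩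
  have : A j * P = P * diagonal fun k => χ k j := by
    ext i k
    have := congrFun (hχ k j) i
    rw [mul_diagonal]
    simpa [P, Module.Basis.toMatrix, mul_apply, mulVec, dotProduct, mul_comm] using this
  rw [mul_assoc, this, ← mul_assoc, h2, one_mul]

/-- Commuting unitary matrices are simultaneously diagonalizable by a unitary matrix. -/
theorem exists_unitary_diagonalization {m n : ℕ} {A : Fin m → Matrix (Fin n) (Fin n) ℂ}
    (hc : ∀ i j, A i * A j = A j * A i) (hu : ∀ i, A i ∈ Matrix.unitaryGroup (Fin n) ℂ) :
    ∃ Q ∈ Matrix.unitaryGroup (Fin n) ℂ, ∃ z : Fin n → Fin m → ℂ,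
      ∀ j, star Q * A j * Q = diagonal fun k => z k j := by
  classical
  have h1 : ∀ i, A i * star (A i) = 1 := fun i => Unitary.mul_star_self_of_mem (hu i)
  have h2 : ∀ i, star (A i) * A i = 1 := fun i => Unitary.star_mul_self_of_mem (hu i)
  have hstar : ∀ i j, A i * star (A j) = star (A j) * A i := fun i j =>
    calc A i * star (A j) = star (A j) * (A j * A i) * star (A j) := by
          rw [← mul_assoc, h2, one_mul]
      _ = star (A j) * A i := by rw [hc j i, mul_assoc, mul_assoc, h1, mul_one]
  have hss : ∀ i j, star (A i) * star (A j) = star (A j) * star (A i) := fun i j => by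
    rw [← star_mul, ← star_mul, hc]
  let B : Fin m × Bool → Matrix (Fin n) (Fin n) ℂ := fun p =>
    if p.2 then A p.1 + star (A p.1) else Complex.I • (A p.1 - star (A p.1))
  have hB : ∀ p, (B p).IsHermitian := by
    rintro ⟨j, _ | _⟩
    · change star _ = _
      simp [B, ← smul_neg]
    · change star _ = _
      simp [B, add_comm]
  have hBc : ∀ p q, B p * B q = B q * B p := by
    rintro ⟨i, _ | _⟩ ⟨j, _ | _⟩ <;>
    simp only [B, if_true, Bool.false_eq_true, if_false, mul_add, add_mul, mul_sub, sub_mul,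
      smul_mul_assoc, mul_smul_comm, hc i j, hss i j, hstar i j, ← hstar j i] <;>
    (try simp only [smul_sub, smul_add]) <;> abel
  let T : Fin m × Bool → (EuclideanSpace ℂ (Fin n) →ₗ[ℂ] EuclideanSpace ℂ (Fin n)) :=
    fun p => toEuclideanLin (B p)
  have hT : ∀ p, (T p).IsSymmetric := fun p => isSymmetric_toEuclideanLin_iff.2 (hB p)
  have hTc : Pairwise (Function.onFun Commute T) := by
    intro p q _
    change T p * T q = T q * T p
    refine LinearMap.ext fun v => WithLp.ofLp_injective 2 ?_
    change B p *ᵥ (B q *ᵥ v.ofLp) = B q *ᵥ (B p *ᵥ v.ofLp)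
    rw [mulVec_mulVec, mulVec_mulVec, hBc]
  have hV' := LinearMap.IsSymmetric.directSum_isInternal_of_pairwise_commute hT hTc
  have : Fintype {χ : Fin m × Bool → ℂ // ⨅ p, Module.End.eigenspace (T p) (χ p) ≠ ⊥} :=
    (WellFoundedGT.finite_ne_bot_of_iSupIndep hV'.submodule_iSupIndep).fintype
  have hV := (DirectSum.isInternal_ne_bot_iff).2 hV'
  have hort := (LinearMap.IsSymmetric.orthogonalFamily_iInf_eigenspaces hT).comp
    (Subtype.val_injective (p := fun χ => ⨅ p, Module.End.eigenspace (T p) (χ p) ≠ ⊥))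
  have hfin : Module.finrank ℂ (EuclideanSpace ℂ (Fin n)) = n := by simp
  let b := hV.subordinateOrthonormalBasis hfin hort
  let γ := fun k => (hV.subordinateOrthonormalBasisIndex hfin k hort).1
  have hb : ∀ k p, B p *ᵥ (b k).ofLp = γ k p • (b k).ofLp := fun k p => by
    have := hV.subordinateOrthonormalBasis_subordinate hfin k hort
    have := Module.End.mem_eigenspace_iff.1 ((Submodule.mem_iInf _).1 this p)
    exact congrArg WithLp.ofLp this
  let Q : Matrix (Fin n) (Fin n) ℂ := of fun i k => (b k).ofLp i
  have hQ : star Q * Q = 1 := by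
    ext i k
    have := orthonormal_iff_ite.1 b.orthonormal i k
    rw [one_apply, ← this]
    simp [Q, mul_apply, star_apply, PiLp.inner_apply, mul_comm]
  have hBQ : ∀ p, B p * Q = Q * diagonal fun k => γ k p := fun p => by
    ext i k
    have := congrFun (hb k p) i
    rw [mul_diagonal]
    simpa [Q, mul_apply, mulVec, dotProduct, mul_comm] using this
  refine ⟨Q, mem_unitaryGroup_iff'.2 hQ,
    fun k j => (1 / 2 : ℂ) * (γ k (j, true) - Complex.I * γ k (j, false)), fun j => ?_⟩
  have hA : A j = (1 / 2 : ℂ) • (B (j, true) - Complex.I • B (j, false)) := by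
    ext i k
    simp [B, ← mul_assoc]
    ring
  have hAQ : A j * Q = Q * diagonal fun k =>
      (1 / 2 : ℂ) * (γ k (j, true) - Complex.I * γ k (j, false)) := by
    rw [hA, smul_mul_assoc, sub_mul, smul_mul_assoc, hBQ, hBQ]
    ext i k
    simp [mul_diagonal]
    ring
  rw [mul_assoc, hAQ, ← mul_assoc, hQ, one_mul]

theorem exists_perm_of_map_univ_eq {ι α : Type*} [Fintype ι] {f g : ι → α}
    (h : Finset.univ.val.map f = Finset.univ.val.map g) : ∃ σ : Equiv.Perm ι, g = f ∘ σ := by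
  classical
  have e : ∀ a, Nonempty ({i // g i = a} ≃ {i // f i = a}) := fun a => by
    refine ⟨Fintype.equivOfCardEq ?_⟩
    have := congrArg (Multiset.count a) h
    rw [Multiset.count_map, Multiset.count_map] at this
    rw [Fintype.card_subtype, Fintype.card_subtype, Finset.card_def, Finset.card_def,
      Finset.filter_val, Finset.filter_val]
    simpa [eq_comm] using this.symm
  exact ⟨Equiv.ofFiberEquiv fun a => (e a).some, funext fun i =>
    (Equiv.ofFiberEquiv_map (fun a => (e a).some) i).symm⟩

/-- Products of linear forms determine the linear forms up to permutation. -/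
theorem exists_perm_of_prod_eq {m n : ℕ} {z w : Fin n → Fin m → ℂ}
    (h : ∀ (c : Fin m → ℂ) (t : ℂ),
      ∏ k, (t - ∑ j, c j * z k j) = ∏ k, (t - ∑ j, c j * w k j)) :
    ∃ σ : Equiv.Perm (Fin n), w = z ∘ σ := by
  let L : (Fin m → ℂ) → MvPolynomial (Fin m) ℂ :=
    fun u => ∑ j, MvPolynomial.X j * MvPolynomial.C (u j)
  have hL : ∀ c u, MvPolynomial.eval c (L u) = ∑ j, c j * u j := fun c u => by simp [L]
  let p : (Fin n → Fin m → ℂ) → Polynomial (MvPolynomial (Fin m) ℂ) :=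
    fun z => ∏ k, (Polynomial.X - Polynomial.C (L (z k)))
  have hp : p z = p w := by
    have hmap : ∀ c, (p z).map (MvPolynomial.eval c) = (p w).map (MvPolynomial.eval c) := by
      intro c
      apply Polynomial.funext
      intro t
      simp only [p, Polynomial.map_prod, Polynomial.eval_prod, Polynomial.map_sub,
        Polynomial.map_X, Polynomial.map_C, Polynomial.eval_sub, Polynomial.eval_X,
        Polynomial.eval_C, hL, h]
    refine Polynomial.ext fun i => MvPolynomial.funext fun c => ?_
    have := congrArg (fun q => Polynomial.coeff q i) (hmap c)
    simpa only [Polynomial.coeff_map] using this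
  have hroots : ∀ z, (p z).roots = Finset.univ.val.map fun k => L (z k) := fun z => by
    have : p z = ((Finset.univ.val.map fun k => L (z k)).map
        fun a => Polynomial.X - Polynomial.C a).prod := by
      rw [Multiset.map_map]; rfl
    rw [this, Polynomial.roots_multiset_prod_X_sub_C]
  have hinj : Function.Injective L := fun u v huv => by
    ext j
    have := congrArg (MvPolynomial.eval (Pi.single j 1)) huv
    simpa [hL, Pi.single_apply] using this
  apply exists_perm_of_map_univ_eq
  apply Multiset.map_injective hinj
  have := hroots z
  rw [hp, hroots w] at this
  rw [Multiset.map_map, Multiset.map_map]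
  exact this.symm

namespace IsJointSpectrum

variable {m n : ℕ} {A : Fin m → Matrix (Fin n) (Fin n) ℂ} {z w : Fin n → Fin m → ℂ}

theorem det_eq (h : IsJointSpectrum A z) (c : Fin m → ℂ) (t : ℂ) :
    (t • (1 : Matrix (Fin n) (Fin n) ℂ) - ∑ j, c j • A j).det = ∏ k, (t - ∑ j, c j * z k j) := by
  obtain ⟨P, Pi, h1, h2, hD⟩ := h
  rw [← det_diagonal]
  have : diagonal (fun k => t - ∑ j, c j * z k j) =
      Pi * (t • (1 : Matrix (Fin n) (Fin n) ℂ) - ∑ j, c j • A j) * P := by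
    simp only [mul_sub, sub_mul, Finset.mul_sum, Finset.sum_mul, mul_smul_comm, smul_mul_assoc,
      hD, mul_one, h2]
    ext i k
    by_cases hik : i = k
    · subst hik; simp [Matrix.sub_apply, Matrix.sum_apply]
    · simp [Matrix.sub_apply, Matrix.sum_apply, hik]
  rw [this, det_mul, det_mul, mul_comm Pi.det, mul_assoc, ← det_mul, h2, det_one, mul_one]

theorem exists_perm (hz : IsJointSpectrum A z) (hw : IsJointSpectrum A w) :
    ∃ σ : Equiv.Perm (Fin n), w = z ∘ σ :=
  exists_perm_of_prod_eq fun c t => by rw [← hz.det_eq, ← hw.det_eq]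

theorem norm_le (h : IsJointSpectrum A z) (k : Fin n) (j : Fin m) :
    ‖z k j‖ ≤ ∑ i, ∑ l, ‖A j i l‖ := by
  obtain ⟨P, Pi, h1, h2, hD⟩ := h
  have hAP : A j * P = P * diagonal fun k => z k j := by
    rw [← hD, ← mul_assoc, ← mul_assoc, h1, one_mul]
  have : Nonempty (Fin n) := ⟨k⟩
  obtain ⟨i, hi⟩ := Finite.exists_max fun i => ‖P i k‖
  have hpos : 0 < ‖P i k‖ := by
    refine (norm_nonneg _).lt_of_ne' fun h0 => ?_
    have h3 : ∀ l, P l k = 0 := fun l => norm_le_zero_iff.1 (h0 ▸ hi l)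
    have := congrFun (congrFun h2 k) k
    simp [mul_apply, h3] at this
  have h4 : ∑ l, A j i l * P l k = P i k * z k j := by
    have := congrFun (congrFun hAP i) k
    rwa [mul_diagonal, mul_apply] at this
  refine le_trans ?_ (Finset.single_le_sum (f := fun i => ∑ l, ‖A j i l‖)
    (fun i _ => Finset.sum_nonneg fun _ _ => norm_nonneg _) (Finset.mem_univ i))
  refine le_of_mul_le_mul_right ?_ hpos
  calc ‖z k j‖ * ‖P i k‖ = ‖∑ l, A j i l * P l k‖ := by rw [h4, norm_mul, mul_comm]
    _ ≤ ∑ l, ‖A j i l‖ * ‖P i k‖ := norm_sum_le_of_le _ fun l _ => by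
        rw [norm_mul]; exact mul_le_mul_of_nonneg_left (hi l) (norm_nonneg _)
    _ = _ := (Finset.sum_mul ..).symm

theorem ne_zero (h : IsJointSpectrum A z) (hA : ∀ j, IsUnit (A j)) (k : Fin n) (j : Fin m) :
    z k j ≠ 0 := by
  obtain ⟨P, Pi, h1, h2, hD⟩ := h
  have : IsUnit (diagonal fun k => z k j) := by
    rw [← hD]
    exact ((IsUnit.of_mul_eq_one _ h2).mul (hA j)).mul (IsUnit.of_mul_eq_one _ h1)
  rw [isUnit_diagonal, _root_.Pi.isUnit_iff] at this
  exact (this k).ne_zero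

theorem conj (h : IsJointSpectrum A z) {B : Fin m → Matrix (Fin n) (Fin n) ℂ}
    {g gi : Matrix (Fin n) (Fin n) ℂ} (h1 : g * gi = 1) (h2 : gi * g = 1)
    (hB : ∀ j, g * A j * gi = B j) : IsJointSpectrum B z := by
  obtain ⟨P, Pi, h3, h4, hD⟩ := h
  refine ⟨g * P, Pi * gi, ?_, ?_, fun j => ?_⟩
  · rw [mul_assoc, ← mul_assoc P, h3, one_mul, h1]
  · rw [mul_assoc, ← mul_assoc gi, h2, one_mul, h4]
  · rw [← hB, ← hD]
    calc Pi * gi * (g * A j * gi) * (g * P) = Pi * (gi * g) * A j * (gi * g) * P := by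
          simp only [mul_assoc]
      _ = _ := by simp only [h2, mul_one]

end IsJointSpectrum

/-- Joint spectra with nonzero entries. -/
abbrev NonzeroSpectrum (m n : ℕ) : Type := {z : Fin n → Fin m → ℂ // ∀ k j, z k j ≠ 0}

open Filter Topology in
/-- Symmetric continuous functions of the joint spectrum depend continuously on the tuple. -/
theorem continuous_comp_jointSpectrum {m n : ℕ} {X Y : Type*} [TopologicalSpace X]
    [TopologicalSpace Y] {A : X → Fin m → Matrix (Fin n) (Fin n) ℂ} (hA : Continuous A)
    {z : X → NonzeroSpectrum m n} (hz : ∀ x, IsJointSpectrum (A x) (z x).1)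
    {f : NonzeroSpectrum m n → Y} (hf : Continuous f)
    (hperm : ∀ (u v : NonzeroSpectrum m n) (σ : Equiv.Perm (Fin n)), v.1 = u.1 ∘ σ → f v = f u) :
    Continuous fun x => f (z x) := by
  rw [continuous_iff_ultrafilter]
  intro x 𝒰 h𝒰
  let b : X → ℝ := fun x => ∑ j, ∑ i, ∑ l, ‖A x j i l‖
  have hb : Continuous b := by fun_prop
  have hball : ∀ᶠ y in (𝒰 : Filter X), (z y).1 ∈ Metric.closedBall 0 (b x + 1) := by
    filter_upwards [h𝒰 (hb.continuousAt.eventually (gt_mem_nhds (lt_add_one (b x))))] with y hy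
    have hle : ∀ k j, ‖(z y).1 k j‖ ≤ b y := fun k j => ((hz y).norm_le k j).trans
      (Finset.single_le_sum (f := fun j => ∑ i, ∑ l, ‖A y j i l‖)
        (fun j _ => by positivity) (Finset.mem_univ j))
    have h0 : 0 ≤ b y := by positivity
    rw [mem_closedBall_zero_iff]
    exact ((pi_norm_le_iff_of_nonneg h0).2 fun k =>
      (pi_norm_le_iff_of_nonneg h0).2 (hle k)).trans hy.le
  obtain ⟨u, -, hu⟩ := (isCompact_closedBall (0 : Fin n → Fin m → ℂ) (b x + 1)).ultrafilter_le_nhds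
    (𝒰.map fun y => (z y).1) (le_principal_iff.2 hball)
  have hu' : Tendsto (fun y => (z y).1) 𝒰 (𝓝 u) := hu
  obtain ⟨σ, hσ⟩ : ∃ σ : Equiv.Perm (Fin n), u = (z x).1 ∘ σ := by
    refine exists_perm_of_prod_eq fun c t => ?_
    rw [← (hz x).det_eq]
    have h1 : Tendsto (fun y => (t • (1 : Matrix (Fin n) (Fin n) ℂ) - ∑ j, c j • A y j).det) 𝒰
        (𝓝 (t • (1 : Matrix (Fin n) (Fin n) ℂ) - ∑ j, c j • A x j).det) := by
      have : Continuous fun y => (t • (1 : Matrix (Fin n) (Fin n) ℂ) - ∑ j, c j • A y j).det := by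
        fun_prop
      exact this.continuousAt.tendsto.mono_left h𝒰
    have h2 : Continuous fun v : Fin n → Fin m → ℂ => ∏ k, (t - ∑ j, c j * v k j) := by
      fun_prop
    refine tendsto_nhds_unique h1 ?_
    simp only [(hz _).det_eq]
    exact (h2.tendsto u).comp hu'
  let u' : NonzeroSpectrum m n := ⟨u, fun k j => by rw [hσ]; exact (z x).2 (σ k) j⟩
  have hu'' : Tendsto z 𝒰 (𝓝 u') := tendsto_subtype_rng.2 hu'
  rw [← hperm (z x) u' σ hσ]
  exact (hf.tendsto u').comp hu''

theorem diagTuple_mul_comm {m n : ℕ} (z : Fin n → Fin m → ℂ) (i j : Fin m) :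
    diagTuple z i * diagTuple z j = diagTuple z j * diagTuple z i := by
  simp [diagTuple, diagonal_mul_diagonal, mul_comm]

theorem diagTuple_mem_ssTuples {m n : ℕ} (z : NonzeroSpectrum m n) :
    diagTuple z.1 ∈ ssTuples m (GLset n) := by
  refine ⟨⟨fun j => ?_, diagTuple_mul_comm z.1⟩, fun j => ⟨1, 1, by simp, by simp, ?_⟩⟩
  · change IsUnit (diagonal _)
    rw [isUnit_diagonal, Pi.isUnit_iff]
    exact fun k => (z.2 k j).isUnit
  · simp [diagTuple]

theorem diagTuple_mem_unitary {m n : ℕ} {z : Fin n → Fin m → ℂ} (hz : ∀ k j, ‖z k j‖ = 1) :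
    diagTuple z ∈ commTuples m (Uset n) := by
  refine ⟨fun j => ?_, diagTuple_mul_comm z⟩
  change diagTuple z j ∈ unitaryGroup (Fin n) ℂ
  rw [mem_unitaryGroup_iff, star_eq_conjTranspose, diagTuple, diagonal_conjTranspose,
    diagonal_mul_diagonal, ← diagonal_one]
  congr 1
  ext k
  simp [Complex.mul_conj, Complex.normSq_eq_norm_sq, hz]

theorem norm_eq_one_of_diagTuple_mem_unitary {m n : ℕ} {z : Fin n → Fin m → ℂ}
    (hz : ∀ j, diagTuple z j ∈ unitaryGroup (Fin n) ℂ) (k : Fin n) (j : Fin m) :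
    ‖z k j‖ = 1 := by
  have h := mem_unitaryGroup_iff.1 (hz j)
  rw [star_eq_conjTranspose, diagTuple, diagonal_conjTranspose, diagonal_mul_diagonal] at h
  have := congrFun (congrFun h k) k
  simp only [diagonal_apply_eq, one_apply_eq, Pi.star_apply, Complex.star_def, Complex.mul_conj,
    Complex.normSq_eq_norm_sq] at this
  exact (pow_eq_one_iff_of_nonneg (norm_nonneg _) two_ne_zero).1 (by exact_mod_cast this)

theorem continuous_diagTuple {m n : ℕ} :
    Continuous (diagTuple : (Fin n → Fin m → ℂ) → Fin m → Matrix (Fin n) (Fin n) ℂ) := by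
  unfold diagTuple
  fun_prop

/-- Permuting a joint spectrum conjugates the diagonal tuple by a permutation matrix. -/
theorem exists_unitary_conj_diagTuple {m n : ℕ} (z : Fin n → Fin m → ℂ)
    (σ : Equiv.Perm (Fin n)) :
    ∃ g ∈ unitaryGroup (Fin n) ℂ, ∀ j, g * diagTuple z j * star g = diagTuple (z ∘ σ) j := by
  let g : Matrix (Fin n) (Fin n) ℂ := (1 : Matrix (Fin n) (Fin n) ℂ).submatrix σ id
  have hg : star g = (1 : Matrix (Fin n) (Fin n) ℂ).submatrix id σ := by
    rw [star_eq_conjTranspose, conjTranspose_submatrix, conjTranspose_one]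
  have hconj : ∀ D : Matrix (Fin n) (Fin n) ℂ, g * D * star g = D.submatrix σ σ := fun D => by
    have h1 : g * D = D.submatrix σ id := by
      simpa using submatrix_mul_equiv 1 D σ (Equiv.refl _) id
    rw [hg, h1]
    simpa using submatrix_mul_equiv D 1 σ (Equiv.refl _) σ
  refine ⟨g, ?_, fun j => ?_⟩
  · rw [mem_unitaryGroup_iff]
    simpa using hconj 1
  · rw [hconj, diagTuple, submatrix_diagonal_equiv]
    rfl

theorem unitary_mem_GLset {n : ℕ} {g : Matrix (Fin n) (Fin n) ℂ}
    (hg : g ∈ unitaryGroup (Fin n) ℂ) : g ∈ GLset n :=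
  IsUnit.of_mul_eq_one _ (mem_unitaryGroup_iff.1 hg)

theorem commTuples_unitary_subset_ssTuples (m n : ℕ) :
    commTuples m (Uset n) ⊆ ssTuples m (GLset n) := by
  intro A hA
  refine ⟨⟨fun j => unitary_mem_GLset (hA.1 j), hA.2⟩, fun j => ?_⟩
  obtain ⟨Q, hQ, z, hz⟩ := exists_unitary_diagonalization hA.2 hA.1
  exact ⟨Q, star Q, mem_unitaryGroup_iff.1 hQ, mem_unitaryGroup_iff'.1 hQ,
    hz j ▸ isDiag_diagonal _⟩

section CharacterVariety

variable {m n : ℕ}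

/-- The class of the diagonal tuple with joint spectrum `z` in the `GL(n,ℂ)`-character variety. -/
def glClass (z : NonzeroSpectrum m n) : RepSpace (GLset n) (ssTuples m (GLset n)) :=
  Quot.mk _ ⟨diagTuple z.1, diagTuple_mem_ssTuples z⟩

theorem continuous_glClass : Continuous (glClass (m := m) (n := n)) :=
  continuous_quot_mk.comp ((continuous_diagTuple.comp continuous_subtype_val).subtype_mk _)

theorem glClass_perm (u v : NonzeroSpectrum m n) (σ : Equiv.Perm (Fin n))
    (h : v.1 = u.1 ∘ σ) : glClass v = glClass u := by
  obtain ⟨g, hg, hconj⟩ := exists_unitary_conj_diagTuple u.1 σ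
  refine (Quot.sound ⟨g, star g, unitary_mem_GLset hg, unitary_mem_GLset (Unitary.star_mem hg),
    mem_unitaryGroup_iff.1 hg, mem_unitaryGroup_iff'.1 hg, fun j => ?_⟩).symm
  rw [hconj, ← h]

theorem mk_eq_glClass (x : ssTuples m (GLset n)) {z : NonzeroSpectrum m n}
    (h : IsJointSpectrum x.1 z.1) : Quot.mk _ x = glClass z := by
  obtain ⟨P, Pi, h1, h2, hD⟩ := h
  exact Quot.sound ⟨Pi, P, IsUnit.of_mul_eq_one _ h2, IsUnit.of_mul_eq_one _ h1, h2, h1, hD⟩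

theorem exists_nonzeroSpectrum (x : ssTuples m (GLset n)) :
    ∃ z : NonzeroSpectrum m n, IsJointSpectrum x.1 z.1 :=
  let ⟨z, hz⟩ := exists_isJointSpectrum x.2.1.2 x.2.2
  ⟨⟨z, hz.ne_zero x.2.1.1⟩, hz⟩

/-- A choice of joint spectrum. -/
noncomputable def jointSpectrum (x : ssTuples m (GLset n)) : NonzeroSpectrum m n :=
  (exists_nonzeroSpectrum x).choose

theorem isJointSpectrum_jointSpectrum (x : ssTuples m (GLset n)) :
    IsJointSpectrum x.1 (jointSpectrum x).1 :=
  (exists_nonzeroSpectrum x).choose_spec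

/-- A symmetric continuous function of the joint spectrum descends to the character variety. -/
noncomputable def liftSpectrum {Y : Type*} [TopologicalSpace Y] (f : NonzeroSpectrum m n → Y)
    (hf : Continuous f)
    (hperm : ∀ (u v : NonzeroSpectrum m n) (σ : Equiv.Perm (Fin n)), v.1 = u.1 ∘ σ → f v = f u) :
    C(RepSpace (GLset n) (ssTuples m (GLset n)), Y) where
  toFun := Quot.lift (fun x => f (jointSpectrum x)) (by
    rintro x y ⟨g, gi, -, -, h1, h2, h⟩
    obtain ⟨σ, hσ⟩ := (isJointSpectrum_jointSpectrum y).exists_perm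
      ((isJointSpectrum_jointSpectrum x).conj h1 h2 h)
    exact hperm _ _ σ hσ)
  continuous_toFun := continuous_quot_lift _
    (continuous_comp_jointSpectrum continuous_subtype_val isJointSpectrum_jointSpectrum hf hperm)

theorem liftSpectrum_glClass {Y : Type*} [TopologicalSpace Y] {f : NonzeroSpectrum m n → Y}
    (hf : Continuous f)
    (hperm : ∀ (u v : NonzeroSpectrum m n) (σ : Equiv.Perm (Fin n)), v.1 = u.1 ∘ σ → f v = f u)
    (z : NonzeroSpectrum m n) : liftSpectrum f hf hperm (glClass z) = f z := by
  obtain ⟨σ, hσ⟩ := (isJointSpectrum_diagTuple z.1).exists_perm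
    (isJointSpectrum_jointSpectrum ⟨diagTuple z.1, diagTuple_mem_ssTuples z⟩)
  exact hperm _ _ σ hσ

theorem exists_eq_glClass (q : RepSpace (GLset n) (ssTuples m (GLset n))) :
    ∃ z, q = glClass z := by
  induction q using Quot.ind with
  | mk x => exact ⟨_, mk_eq_glClass x (isJointSpectrum_jointSpectrum x)⟩

/-- The straight-line radial deformation of nonzero joint spectra onto those of norm one. -/
noncomputable def radial (t : unitInterval) (z : NonzeroSpectrum m n) : NonzeroSpectrum m n :=
  ⟨fun k j => ((1 - t + t * ‖z.1 k j‖⁻¹ : ℝ) : ℂ) * z.1 k j, fun k j => by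
    refine mul_ne_zero (Complex.ofReal_ne_zero.2 (ne_of_gt ?_)) (z.2 k j)
    have hz : 0 < ‖z.1 k j‖⁻¹ := inv_pos.2 (norm_pos_iff.2 (z.2 k j))
    rcases t.2.2.lt_or_eq with h | h
    · have := mul_nonneg t.2.1 hz.le
      linarith
    · simpa [h] using z.2 k j⟩

theorem continuous_radial :
    Continuous fun p : NonzeroSpectrum m n × unitInterval => radial p.2 p.1 := by
  refine Continuous.subtype_mk (continuous_pi fun k => continuous_pi fun j => ?_) _
  have hz : Continuous fun p : NonzeroSpectrum m n × unitInterval => p.1.1 k j :=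
    (continuous_apply_apply k j).comp (continuous_subtype_val.comp continuous_fst)
  have hinv : Continuous fun p : NonzeroSpectrum m n × unitInterval => ‖p.1.1 k j‖⁻¹ :=
    hz.norm.inv₀ fun p => norm_ne_zero_iff.2 (p.1.2 k j)
  have ht : Continuous fun p : NonzeroSpectrum m n × unitInterval => (p.2 : ℝ) :=
    continuous_subtype_val.comp continuous_snd
  exact (Complex.continuous_ofReal.comp
    ((continuous_const.sub ht).add (ht.mul hinv))).mul hz

theorem radial_zero (z : NonzeroSpectrum m n) : radial 0 z = z := by
  ext; simp [radial]

theorem norm_radial_one (z : NonzeroSpectrum m n) (k : Fin n) (j : Fin m) :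
    ‖(radial 1 z).1 k j‖ = 1 := by
  have := norm_ne_zero_iff.2 (z.2 k j)
  simp [radial, this]

theorem radial_one_eq_self {z : NonzeroSpectrum m n} (hz : ∀ k j, ‖z.1 k j‖ = 1) :
    radial 1 z = z := by
  ext; simp [radial, hz]

theorem radial_perm {u v : NonzeroSpectrum m n} {σ : Equiv.Perm (Fin n)} (h : v.1 = u.1 ∘ σ)
    (t : unitInterval) : (radial t v).1 = (radial t u).1 ∘ σ := by
  ext; simp [radial, h]

/-- The class in the `U(n)`-character variety of the normalized diagonal tuple. -/
noncomputable def unitaryClass (z : NonzeroSpectrum m n) :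
    RepSpace (Uset n) (commTuples m (Uset n)) :=
  Quot.mk _ ⟨diagTuple (radial 1 z).1, diagTuple_mem_unitary (norm_radial_one z)⟩

theorem continuous_unitaryClass : Continuous (unitaryClass (m := m) (n := n)) :=
  continuous_quot_mk.comp ((continuous_diagTuple.comp (continuous_subtype_val.comp
    (continuous_radial.comp (continuous_id.prodMk continuous_const)))).subtype_mk _)

theorem unitaryClass_perm (u v : NonzeroSpectrum m n) (σ : Equiv.Perm (Fin n))
    (h : v.1 = u.1 ∘ σ) : unitaryClass v = unitaryClass u := by
  obtain ⟨g, hg, hconj⟩ := exists_unitary_conj_diagTuple (radial 1 u).1 σ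
  refine (Quot.sound ⟨g, star g, hg, Unitary.star_mem hg,
    mem_unitaryGroup_iff.1 hg, mem_unitaryGroup_iff'.1 hg, fun j => ?_⟩).symm
  rw [hconj, ← radial_perm h]

theorem exists_eq_unitaryClass (x : commTuples m (Uset n)) :
    ∃ z, IsJointSpectrum x.1 z.1 ∧ Quot.mk _ x = unitaryClass z := by
  obtain ⟨Q, hQ, z, hz⟩ := exists_unitary_diagonalization x.2.2 x.2.1
  have hQs := Unitary.star_mem hQ
  have hnorm : ∀ k j, ‖z k j‖ = 1 := norm_eq_one_of_diagTuple_mem_unitary fun j => by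
    rw [diagTuple, ← hz j]
    exact mul_mem (mul_mem hQs (x.2.1 j)) hQ
  let z' : NonzeroSpectrum m n := ⟨z, fun k j => norm_ne_zero_iff.1 (by simp [hnorm])⟩
  refine ⟨z', ⟨Q, star Q, mem_unitaryGroup_iff.1 hQ, mem_unitaryGroup_iff'.1 hQ, hz⟩, ?_⟩
  refine Quot.sound ⟨star Q, Q, hQs, hQ, mem_unitaryGroup_iff'.1 hQ, mem_unitaryGroup_iff.1 hQ,
    fun j => ?_⟩
  change _ = diagTuple (radial 1 z').1 j
  rw [radial_one_eq_self hnorm]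
  exact hz j

/-- The map of character varieties induced by the inclusion of `U(n)` in `GL(n,ℂ)`. -/
def unitaryInclusion (m n : ℕ) :
    C(RepSpace (Uset n) (commTuples m (Uset n)), RepSpace (GLset n) (ssTuples m (GLset n))) where
  toFun := Quot.map (Set.inclusion (commTuples_unitary_subset_ssTuples m n))
    fun _ _ ⟨g, gi, hg, hgi, h⟩ => ⟨g, gi, unitary_mem_GLset hg, unitary_mem_GLset hgi, h⟩
  continuous_toFun := continuous_quot_lift _
    (continuous_quot_mk.comp (continuous_inclusion (commTuples_unitary_subset_ssTuples m n)))

/-- The retraction of the `GL(n,ℂ)`-character variety onto the `U(n)`-character variety. -/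
noncomputable def unitaryRetraction (m n : ℕ) :
    C(RepSpace (GLset n) (ssTuples m (GLset n)), RepSpace (Uset n) (commTuples m (Uset n))) :=
  liftSpectrum unitaryClass continuous_unitaryClass unitaryClass_perm

theorem unitaryRetraction_comp_unitaryInclusion (m n : ℕ) :
    (unitaryRetraction m n).comp (unitaryInclusion m n) = ContinuousMap.id _ := by
  ext q
  induction q using Quot.ind with
  | mk x =>
    obtain ⟨z, hz, hx⟩ := exists_eq_unitaryClass x
    have : unitaryInclusion m n (Quot.mk _ x) = glClass z :=
      mk_eq_glClass (Set.inclusion (commTuples_unitary_subset_ssTuples m n) x) hz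
    rw [ContinuousMap.comp_apply, this, unitaryRetraction, liftSpectrum_glClass, ← hx]
    rfl

theorem id_homotopic_unitaryInclusion_comp_unitaryRetraction (m n : ℕ) :
    (ContinuousMap.id _).Homotopic ((unitaryInclusion m n).comp (unitaryRetraction m n)) := by
  let path : C(NonzeroSpectrum m n,
      C(unitInterval, RepSpace (GLset n) (ssTuples m (GLset n)))) :=
    ContinuousMap.curry ⟨fun p => glClass (radial p.2 p.1),
      continuous_glClass.comp continuous_radial⟩
  have hperm : ∀ (u v : NonzeroSpectrum m n) (σ : Equiv.Perm (Fin n)), v.1 = u.1 ∘ σ →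
      path v = path u := fun u v σ h => by
    ext t
    exact glClass_perm _ _ σ (radial_perm h t)
  let H := liftSpectrum path path.continuous hperm
  refine ⟨⟨⟨fun p => H p.2 p.1, ?_⟩, fun q => ?_, fun q => ?_⟩⟩
  · exact (ContinuousMap.continuous_uncurry_of_continuous H).comp continuous_swap
  · obtain ⟨z, rfl⟩ := exists_eq_glClass q
    change liftSpectrum path path.continuous hperm (glClass z) 0 = glClass z
    rw [liftSpectrum_glClass]
    change glClass (radial 0 z) = _
    rw [radial_zero]
  · obtain ⟨z, rfl⟩ := exists_eq_glClass q
    change liftSpectrum path path.continuous hperm (glClass z) 1 = _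
    rw [liftSpectrum_glClass, ContinuousMap.comp_apply, unitaryRetraction, liftSpectrum_glClass]
    rfl

end CharacterVariety

/-- Corollary 4.6 of Biswas–Florentino for `G = GL(n,ℂ)`, `K = U(n)`:
the spaces `Hom(ℤ^{2d},GL(n,ℂ))⁺/GL(n,ℂ)` and `Hom(ℤ^{2d},U(n))/U(n)` are
homotopy equivalent. -/
theorem generalLinear_char_variety_homotopyEquiv_unitary (n d : ℕ) (hn : 1 ≤ n) :
    Nonempty
      (ContinuousMap.HomotopyEquiv
        (RepSpace (GLset n) (ssTuples (2*d) (GLset n)))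
        (RepSpace (Uset n) (commTuples (2*d) (Uset n)))) :=
  ⟨{ toFun := unitaryRetraction (2 * d) n
     invFun := unitaryInclusion (2 * d) n
     left_inv := (id_homotopic_unitaryInclusion_comp_unitaryRetraction (2 * d) n).symm
     right_inv := by rw [unitaryRetraction_comp_unitaryInclusion] }⟩
end
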